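/- arXiv:2407.06361 — 4 statements merged into one kernel-verified Lean document; each statement's English description precedes it below -/
import Mathlib

section
/- Fix distinct points x, z ∈ S¹. Then the points ξ¹(z) and ℙ(ξ²(x) ∩ ξ²(z)) of the projective line ℙ(ξ²(z)) = {p ∈ ℙ(ℝ³) : p ⊆ ξ²(z)} are distinct, the set ℙ(ξ²(z)) ∖ {ξ¹(z), ℙ(ξ²(x) ∩ ξ²(z))} has exactly two connected components, and the map y ↦ ℙ(ξ²(y) ∩ ξ²(z)) restricts to a homeomorphism from the open arc {y : (x,y,z) is positively oriented} onto one of these two components and to a homeomorphism from the open arc {y : (z,y,x) is positively oriented} onto the other component. -/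
noncomputable section

open Filter Topology Module
open scoped LinearAlgebra.Projectivization

namespace CFF

instance {K V : Type*} [DivisionRing K] [AddCommGroup V] [Module K V] [TopologicalSpace V] :
    TopologicalSpace (ℙ K V) :=
  inferInstanceAs (TopologicalSpace (Quotient (projectivizationSetoid K V)))

instance : TopologicalSpace (Module.Dual ℝ (Fin 3 → ℝ)) :=
  TopologicalSpace.induced (LinearEquiv.piRing ℝ ℝ (Fin 3) ℝ) inferInstance

/-- The projective line in `ℙ(ℝ³)` determined by a plane `W ≤ ℝ³`. -/
def projLine (W : Submodule ℝ (Fin 3 → ℝ)) : Set (ℙ ℝ (Fin 3 → ℝ)) :=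
  {p | p.submodule ≤ W}

/-- `C ⊆ ℙ(ℝ³)` is properly convex: there is a linear functional `f` nonzero on every nonzero
vector spanning a point of the closure of `C`, such that the image of `C` in the affine chart
`{[v] : f v = 1}` is convex. -/
def ProperlyConvex (C : Set (ℙ ℝ (Fin 3 → ℝ))) : Prop :=
  ∃ f : (Fin 3 → ℝ) →ₗ[ℝ] ℝ,
    (∀ (v : Fin 3 → ℝ) (hv : v ≠ 0), Projectivization.mk ℝ v hv ∈ closure C → f v ≠ 0) ∧
    Convex ℝ {w : Fin 3 → ℝ | f w = 1 ∧ ∃ hw : w ≠ 0, Projectivization.mk ℝ w hw ∈ C}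

/-- The frontier of `C` contains no three distinct collinear points. -/
def StrictlyConvexBoundary (C : Set (ℙ ℝ (Fin 3 → ℝ))) : Prop :=
  ∀ p q r : ℙ ℝ (Fin 3 → ℝ), p ∈ frontier C → q ∈ frontier C → r ∈ frontier C →
    p ≠ q → p ≠ r → q ≠ r →
    ∀ W : Submodule ℝ (Fin 3 → ℝ), finrank ℝ W = 2 →
      ¬ (p.submodule ≤ W ∧ q.submodule ≤ W ∧ r.submodule ≤ W)

/-- `W` determines a supporting line of `C` at the frontier point `p`: a projective line
containing `p` and disjoint from `C`. -/
def IsSupportingLineAt (C : Set (ℙ ℝ (Fin 3 → ℝ))) (W : Submodule ℝ (Fin 3 → ℝ))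
    (p : ℙ ℝ (Fin 3 → ℝ)) : Prop :=
  finrank ℝ W = 2 ∧ p ∈ frontier C ∧ p.submodule ≤ W ∧ projLine W ∩ C = ∅

/-- `(x, y, z)` is a positively oriented triple on the circle: `y` and `z` occur in that order
when traversing the circle counterclockwise starting from `x`.  (This implies the three points
are pairwise distinct.) -/
def PosOriented (x y z : Circle) : Prop :=
  ∃ a b c : ℝ, Circle.exp a = x ∧ Circle.exp b = y ∧ Circle.exp c = z ∧
    a < b ∧ b < c ∧ c < a + 2 * Real.pi

/-- The space of flags `(p, l)`, realized inside `ℙ(ℝ³) × ℙ((ℝ³)*)`: the pair `(p, φ)`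
represents the flag whose line is the plane annihilated by `φ`, and `p` must lie on it. -/
def Flags : Set (ℙ ℝ (Fin 3 → ℝ) × ℙ ℝ (Module.Dual ℝ (Fin 3 → ℝ))) :=
  {pl | pl.1.submodule ≤ pl.2.submodule.dualCoannihilator}

/-- The flags `(p, l)` with `p` outside the closure of `C` and `ℙ(l)` meeting `C`. -/
def Omega2 (C : Set (ℙ ℝ (Fin 3 → ℝ))) :
    Set (ℙ ℝ (Fin 3 → ℝ) × ℙ ℝ (Module.Dual ℝ (Fin 3 → ℝ))) :=
  {pl | pl ∈ Flags ∧ pl.1 ∉ closure C ∧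
    ∃ q ∈ C, q.submodule ≤ pl.2.submodule.dualCoannihilator}


abbrev E3 := Fin 3 → ℝ

theorem mk'_continuous : Continuous (Projectivization.mk' ℝ : {v : E3 // v ≠ 0} → ℙ ℝ E3) :=
  continuous_quot_mk

theorem mk'_isOpenMap : IsOpenMap (Projectivization.mk' ℝ : {v : E3 // v ≠ 0} → ℙ ℝ E3) := by
  intro U hU
  change IsOpen ((Projectivization.mk' ℝ : {v : E3 // v ≠ 0} → ℙ ℝ E3) ⁻¹' _)
  have : (Projectivization.mk' ℝ : {v : E3 // v ≠ 0} → ℙ ℝ E3) ⁻¹'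
      ((Projectivization.mk' ℝ : {v : E3 // v ≠ 0} → ℙ ℝ E3) '' U) =
      ⋃ a : ℝˣ, (fun v : {v : E3 // v ≠ 0} => (⟨a • v.1, by
        rw [Units.smul_def]; exact smul_ne_zero a.ne_zero v.2⟩ : {v : E3 // v ≠ 0})) ⁻¹' U := by
    ext v
    simp only [Set.mem_preimage, Set.mem_image, Set.mem_iUnion, Projectivization.mk'_eq_mk]
    constructor
    · rintro ⟨u, hu, h⟩
      obtain ⟨a, ha⟩ := (Projectivization.mk_eq_mk_iff ℝ _ _ _ _).1 h
      exact ⟨a, by convert hu⟩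
    · rintro ⟨a, ha⟩
      exact ⟨_, ha, (Projectivization.mk_eq_mk_iff ℝ _ _ _ _).2 ⟨a, rfl⟩⟩
  rw [this]
  refine isOpen_iUnion fun a => hU.preimage ?_
  refine Continuous.subtype_mk ?_ _
  simp only [Units.smul_def]
  fun_prop

theorem nhds_mk (v : E3) (hv : v ≠ 0) :
    𝓝 (Projectivization.mk ℝ v hv) = map (Projectivization.mk' ℝ) (𝓝 ⟨v, hv⟩) :=
  (mk'_isOpenMap.map_nhds_eq mk'_continuous.continuousAt).symm

theorem continuous_mk_comp {X : Type*} [TopologicalSpace X] (g : X → E3) (hg : Continuous g)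
    (h0 : ∀ t, g t ≠ 0) : Continuous fun t => Projectivization.mk ℝ (g t) (h0 t) :=
  mk'_continuous.comp (hg.subtype_mk h0)

theorem continuousAt_of_mk {Y : Type*} [TopologicalSpace Y] (F : ℙ ℝ E3 → Y) (G : E3 → Y)
    (v : E3) (hv : v ≠ 0) (hFG : ∀ w (hw : w ≠ 0), F (Projectivization.mk ℝ w hw) = G w)
    (hG : ContinuousAt G v) : ContinuousAt F (Projectivization.mk ℝ v hv) := by
  rw [ContinuousAt, nhds_mk, tendsto_map'_iff, hFG]
  have : (F ∘ Projectivization.mk' ℝ) = G ∘ (Subtype.val : {v : E3 // v ≠ 0} → E3) := by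
    ext w; exact hFG w.1 w.2
  rw [this]
  exact hG.tendsto.comp continuous_subtype_val.continuousAt

theorem exists_mem_of_closure (C : Set (ℙ ℝ E3)) (v : E3) (hv : v ≠ 0)
    (h : Projectivization.mk ℝ v hv ∈ closure C) (N : Set E3) (hN : IsOpen N) (hvN : v ∈ N) :
    ∃ w ∈ N, ∃ hw : w ≠ 0, Projectivization.mk ℝ w hw ∈ C := by
  have := mem_closure_iff.1 h _ (mk'_isOpenMap _ (hN.preimage
    (continuous_subtype_val : Continuous (Subtype.val : {v : E3 // v ≠ 0} → E3))))
    ⟨⟨v, hv⟩, hvN, rfl⟩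
  obtain ⟨p, ⟨w, hw, rfl⟩, hp⟩ := this
  exact ⟨w.1, hw, w.2, hp⟩

/-! circle parametrization -/

def Dp (z : Circle) (t : ℝ) : Circle := z * Circle.exp Real.pi * Circle.exp (2 * Real.arctan t)

theorem Dp_eq (z : Circle) (θ : ℝ) (hθ : Circle.exp θ = z * Circle.exp Real.pi) (t : ℝ) :
    Dp z t = Circle.exp (θ + 2 * Real.arctan t) := by
  rw [Dp, Circle.exp_add, hθ]

theorem Dp_continuous (z : Circle) : Continuous (Dp z) := by
  unfold Dp
  exact continuous_const.mul (Circle.exp.continuous.comp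
    (continuous_const.mul Real.continuous_arctan))

theorem inducing_of_left {X Y : Type*} [TopologicalSpace X] [TopologicalSpace Y] (f : X → Y)
    (g : Y → X) (hf : Continuous f) (hgf : ∀ t, g (f t) = t) (hg : ∀ t, ContinuousAt g (f t)) :
    IsEmbedding f := by
  refine ⟨isInducing_iff_nhds.2 fun t => le_antisymm ?_ ?_, fun a b h => by
    rw [← hgf a, h, hgf]⟩
  · exact hf.continuousAt.tendsto.le_comap
  · have h1 := (hg t).tendsto.comp (tendsto_comap (f := f) (x := 𝓝 (f t)))
    have h2 : g ∘ f = id := funext hgf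
    rw [h2, hgf] at h1
    exact h1

theorem Dp_embedding (z : Circle) : IsEmbedding (Dp z) := by
  have key : ∀ t, Complex.arg (((z * Circle.exp Real.pi)⁻¹ * Dp z t : Circle) : ℂ)
      = 2 * Real.arctan t := by
    intro t
    rw [Dp, inv_mul_cancel_left, Circle.arg_exp]
    · linarith [Real.neg_pi_div_two_lt_arctan t]
    · linarith [Real.arctan_lt_pi_div_two t]
  refine inducing_of_left _ (fun y => Real.tan
    (Complex.arg (((z * Circle.exp Real.pi)⁻¹ * y : Circle) : ℂ) / 2)) (Dp_continuous z) ?_ ?_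
  · intro t
    simp only [key]
    rw [mul_div_cancel_left₀ _ two_ne_zero, Real.tan_arctan]
  · intro t
    have h1 : ContinuousAt Real.tan
      (Complex.arg (((z * Circle.exp Real.pi)⁻¹ * Dp z t : Circle) : ℂ) / 2) := by
      rw [Real.continuousAt_tan, key, mul_div_cancel_left₀ _ two_ne_zero]
      exact (Real.cos_arctan_pos t).ne'
    refine ContinuousAt.comp (f := fun y : Circle =>
      Complex.arg (((z * Circle.exp Real.pi)⁻¹ * y : Circle) : ℂ) / 2) h1 ?_
    refine ContinuousAt.div_const ?_ _
    refine ContinuousAt.comp (g := Complex.arg) (f := fun y : Circle =>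
      (((z * Circle.exp Real.pi)⁻¹ * y : Circle) : ℂ)) ?_ ?_
    · apply Complex.continuousAt_arg
      rw [Complex.mem_slitPlane_iff_arg, key]
      refine ⟨?_, Circle.coe_ne_zero _⟩
      intro h
      linarith [Real.arctan_lt_pi_div_two t]
    · have h9 : Continuous fun y : Circle => (z * Circle.exp Real.pi)⁻¹ * y := by fun_prop
      exact (Continuous.comp (g := fun w : Circle => (w : ℂ)) (by fun_prop) h9).continuousAt

theorem exp_pi_sq : Circle.exp Real.pi * Circle.exp Real.pi = 1 := by
  rw [← Circle.exp_add, ← two_mul, Circle.exp_two_pi]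

theorem exists_Dp (z : Circle) (θ b : ℝ) (hθ : Circle.exp θ = z * Circle.exp Real.pi)
    (h1 : θ - Real.pi < b) (h2 : b < θ + Real.pi) :
    Dp z (Real.tan ((b - θ) / 2)) = Circle.exp b := by
  rw [Dp_eq z θ hθ, Real.arctan_tan (by linarith) (by linarith)]
  congr 1; ring

theorem exp_sub_pi (c : ℝ) : Circle.exp (c - Real.pi) = Circle.exp c * Circle.exp Real.pi := by
  rw [Circle.exp_sub, div_eq_iff_eq_mul, mul_assoc, exp_pi_sq, mul_one]

theorem Dp_ne (z : Circle) (t : ℝ) : Dp z t ≠ z := by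
  intro h
  obtain ⟨c, hc⟩ := Circle.exp_surjective z
  have h3 := Dp_eq z (c - Real.pi) (by rw [exp_sub_pi, hc]) t
  rw [h, ← hc] at h3
  have h1 := Real.neg_pi_div_two_lt_arctan t
  have h2 := Real.arctan_lt_pi_div_two t
  have := Circle.exp_injOn_Ioc (a := c - 2 * Real.pi) (b := c) (by linarith)
    ⟨by linarith [Real.pi_pos], le_refl _⟩ ⟨by linarith, by linarith⟩ h3
  linarith

theorem exists_Dp_of_ne (z y : Circle) (h : y ≠ z) : ∃ t, Dp z t = y := by
  set w := (z * Circle.exp Real.pi)⁻¹ * y with hw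
  have h1 := Complex.neg_pi_lt_arg (w : ℂ)
  have h2 := Complex.arg_le_pi (w : ℂ)
  have h3 : Circle.exp (Complex.arg (w : ℂ)) = w := Circle.exp_arg w
  have h4 : Complex.arg (w : ℂ) ≠ Real.pi := by
    intro h4
    rw [h4] at h3
    apply h
    rw [eq_inv_mul_iff_mul_eq, mul_assoc, exp_pi_sq, mul_one] at h3
    exact h3.symm
  have h5 := lt_of_le_of_ne h2 h4
  refine ⟨Real.tan (Complex.arg (w : ℂ) / 2), ?_⟩
  rw [Dp, Real.arctan_tan (by linarith) (by linarith), mul_div_cancel₀ _ two_ne_zero, h3, hw,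
    mul_inv_cancel_left]

theorem tan_lt (a b θ : ℝ) (h1 : θ - Real.pi < a) (h : a < b) (h2 : b < θ + Real.pi) :
    Real.tan ((a - θ) / 2) < Real.tan ((b - θ) / 2) :=
  Real.strictMonoOn_tan ⟨by linarith, by linarith⟩ ⟨by linarith, by linarith⟩ (by linarith)

theorem posOriented_iff₁ (z y : Circle) (t₀ : ℝ) :
    PosOriented (Dp z t₀) y z ↔ y ∈ Dp z '' Set.Ioi t₀ := by
  constructor
  · rintro ⟨a, b, c, ha, hb, hc, hab, hbc, hca⟩
    have hθ : Circle.exp (c - Real.pi) = z * Circle.exp Real.pi := by rw [exp_sub_pi, hc]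
    refine ⟨Real.tan ((b - (c - Real.pi)) / 2), ?_, ?_⟩
    · have h1 := exists_Dp z _ a hθ (by linarith) (by linarith)
      rw [ha] at h1
      have := (Dp_embedding z).injective h1
      rw [Set.mem_Ioi, ← this]
      exact tan_lt _ _ _ (by linarith) hab (by linarith)
    · rw [exists_Dp z _ b hθ (by linarith) (by linarith), hb]
  · rintro ⟨t, ht, rfl⟩
    obtain ⟨c, hc⟩ := Circle.exp_surjective z
    have hθ : Circle.exp (c - Real.pi) = z * Circle.exp Real.pi := by rw [exp_sub_pi, hc]
    refine ⟨_, _, c, (Dp_eq z _ hθ _).symm, (Dp_eq z _ hθ _).symm, hc, ?_, ?_, ?_⟩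
    · linarith [Real.arctan_strictMono ht]
    · linarith [Real.arctan_lt_pi_div_two t]
    · linarith [Real.neg_pi_div_two_lt_arctan t₀]

theorem posOriented_iff₂ (z y : Circle) (t₀ : ℝ) :
    PosOriented z y (Dp z t₀) ↔ y ∈ Dp z '' Set.Iio t₀ := by
  constructor
  · rintro ⟨c, b, a, hc, hb, ha, hcb, hba, hac⟩
    have hθ : Circle.exp (c + Real.pi) = z * Circle.exp Real.pi := by rw [Circle.exp_add, hc]
    refine ⟨Real.tan ((b - (c + Real.pi)) / 2), ?_, ?_⟩
    · have h1 := exists_Dp z _ a hθ (by linarith) (by linarith)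
      rw [ha] at h1
      have := (Dp_embedding z).injective h1
      rw [Set.mem_Iio, ← this]
      exact tan_lt _ _ _ (by linarith) hba (by linarith)
    · rw [exists_Dp z _ b hθ (by linarith) (by linarith), hb]
  · rintro ⟨t, ht, rfl⟩
    obtain ⟨c, hc⟩ := Circle.exp_surjective z
    have hθ : Circle.exp (c + Real.pi) = z * Circle.exp Real.pi := by rw [Circle.exp_add, hc]
    refine ⟨c, _, _, hc, (Dp_eq z _ hθ _).symm, (Dp_eq z _ hθ _).symm, ?_, ?_, ?_⟩
    · linarith [Real.neg_pi_div_two_lt_arctan t]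
    · linarith [Real.arctan_strictMono ht]
    · linarith [Real.arctan_lt_pi_div_two t₀]

/-! components and homeomorphisms -/

theorem comp_Ioi {X : Type*} [TopologicalSpace X] (M : ℝ → X) (hM : IsEmbedding M) (t₀ t : ℝ)
    (ht : t₀ < t) : connectedComponentIn (M '' {t₀}ᶜ) (M t) = M '' Set.Ioi t₀ := by
  have hsub : M '' Set.Ioi t₀ ⊆ M '' {t₀}ᶜ := Set.image_mono fun s hs => ne_of_gt hs
  apply Set.Subset.antisymm
  · intro p hp
    have hp' := connectedComponentIn_subset _ _ hp
    obtain ⟨s, hs, rfl⟩ := hp'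
    refine ⟨s, ?_, rfl⟩
    have hpre : IsPreconnected (M ⁻¹' connectedComponentIn (M '' {t₀}ᶜ) (M t)) := by
      refine hM.isInducing.isPreconnected_image.1 ?_
      rw [Set.image_preimage_eq_of_subset]
      · exact isPreconnected_connectedComponentIn
      · exact (connectedComponentIn_subset _ _).trans (Set.image_subset_range _ _)
    by_contra hs'
    have hm : t ∈ M ⁻¹' connectedComponentIn (M '' {t₀}ᶜ) (M t) :=
      mem_connectedComponentIn ⟨t, ne_of_gt ht, rfl⟩
    have := hpre.ordConnected.out hp hm ⟨not_lt.1 hs', ht.le⟩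
    obtain ⟨u, hu, h⟩ := connectedComponentIn_subset _ _ this
    exact hu (hM.injective h)
  · exact (isPreconnected_Ioi.image _ hM.continuous.continuousOn).subset_connectedComponentIn
      ⟨t, ht, rfl⟩ hsub

theorem comp_Iio {X : Type*} [TopologicalSpace X] (M : ℝ → X) (hM : IsEmbedding M) (t₀ t : ℝ)
    (ht : t < t₀) : connectedComponentIn (M '' {t₀}ᶜ) (M t) = M '' Set.Iio t₀ := by
  have h := comp_Ioi (M ∘ Neg.neg) (hM.comp (Homeomorph.neg ℝ).isEmbedding) (-t₀) (-t)
    (by linarith)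
  simp only [Set.image_comp] at h
  rw [Set.image_neg_eq_neg, Set.image_neg_eq_neg] at h
  simpa using h

theorem exists_homeo {X Y : Type*} [TopologicalSpace X] [TopologicalSpace Y] (D : ℝ → X)
    (M : ℝ → Y) (hD : IsEmbedding D) (hM : IsEmbedding M) (η : X → Y) (h : ∀ t, η (D t) = M t)
    (I : Set ℝ) (P : X → Prop) (hP : ∀ y, P y ↔ y ∈ D '' I) :
    ∃ e : {y // P y} ≃ₜ ↥(M '' I), ∀ a, (e a : Y) = η ↑a := by
  obtain rfl : P = fun y => y ∈ D '' I := funext fun y => propext (hP y)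
  refine ⟨(hD.homeomorphImage I).symm.trans (hM.homeomorphImage I), fun a => ?_⟩
  obtain ⟨t, rfl⟩ := (hD.homeomorphImage I).surjective a
  simp only [Homeomorph.trans_apply]
  rw [show ((hD.homeomorphImage I).symm ((hD.homeomorphImage I) t)) = t from
    (hD.homeomorphImage I).symm_apply_apply t]
  exact (h t).symm

theorem embedding_real (k : ℝ → ℝ) (hc : Continuous k) (hi : Function.Injective k)
    (hs : Function.Surjective k) : IsEmbedding k := by
  rcases hc.strictMono_of_inj hi with h | h
  · exact h.isEmbedding_of_ordConnected (by rw [hs.range_eq]; exact Set.ordConnected_univ)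
  · have h2 : StrictMono (fun t => - k t) := fun a b hab => neg_lt_neg (h hab)
    have h3 : Function.Surjective (fun t => - k t) := fun y => by
      obtain ⟨t, ht⟩ := hs (-y); exact ⟨t, by simp [ht]⟩
    have h4 := h2.isEmbedding_of_ordConnected (by rw [h3.range_eq]; exact Set.ordConnected_univ)
    have := (Homeomorph.neg ℝ).isEmbedding.comp h4
    convert this using 1
    ext t; simp

/-! the cone over `C` -/

def cone (C : Set (ℙ ℝ E3)) (f : E3 →ₗ[ℝ] ℝ) : Set E3 :=
  {v | 0 < f v ∧ ∃ hv : v ≠ 0, Projectivization.mk ℝ v hv ∈ C}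

theorem f_cont (f : E3 →ₗ[ℝ] ℝ) : Continuous f := f.continuous_of_finiteDimensional

theorem mk_smul_eq (c : ℝ) (_hc : c ≠ 0) (v : E3) (hv : v ≠ 0) (hcv : c • v ≠ 0) :
    Projectivization.mk ℝ (c • v) hcv = Projectivization.mk ℝ v hv :=
  (Projectivization.mk_eq_mk_iff' ℝ _ _ _ _).2 ⟨c, rfl⟩

theorem cone_smul (C : Set (ℙ ℝ E3)) (f : E3 →ₗ[ℝ] ℝ) (c : ℝ) (hc : 0 < c) (v : E3)
    (hv : v ∈ cone C f) : c • v ∈ cone C f := by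
  obtain ⟨h1, h2, h3⟩ := hv
  refine ⟨by rw [map_smul]; exact mul_pos hc h1, smul_ne_zero hc.ne' h2, ?_⟩
  rwa [mk_smul_eq c hc.ne' v h2]

theorem cone_add (C : Set (ℙ ℝ E3)) (f : E3 →ₗ[ℝ] ℝ)
    (hK : Convex ℝ {w : E3 | f w = 1 ∧ ∃ hw : w ≠ 0, Projectivization.mk ℝ w hw ∈ C})
    (v w : E3) (hv : v ∈ cone C f) (hw : w ∈ cone C f) : v + w ∈ cone C f := by
  have key : ∀ u ∈ cone C f, (f u)⁻¹ • u ∈ {w : E3 | f w = 1 ∧ ∃ hw : w ≠ 0,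
      Projectivization.mk ℝ w hw ∈ C} := by
    intro u hu
    refine ⟨?_, (cone_smul C f _ (inv_pos.2 hu.1) u hu).2⟩
    rw [map_smul, smul_eq_mul, inv_mul_cancel₀ hu.1.ne']
  have hs : 0 < f v + f w := add_pos hv.1 hw.1
  have h := hK (key v hv) (key w hw) (div_nonneg hv.1.le hs.le) (div_nonneg hw.1.le hs.le)
    (by rw [← add_div, div_self hs.ne'])
  have h2 := cone_smul C f (f v + f w) hs _ ⟨by rw [h.1]; exact one_pos, h.2⟩
  convert h2 using 1
  have := hv.1.ne'
  have := hw.1.ne'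
  rw [smul_add, smul_smul, smul_smul, smul_smul, smul_smul]
  congr 1
  · rw [show (f v + f w) * (f v / (f v + f w)) * (f v)⁻¹ = 1 by field_simp, one_smul]
  · rw [show (f v + f w) * (f w / (f v + f w)) * (f w)⁻¹ = 1 by field_simp, one_smul]

theorem cone_open (C : Set (ℙ ℝ E3)) (hC : IsOpen C) (f : E3 →ₗ[ℝ] ℝ) : IsOpen (cone C f) := by
  have h1 : IsOpen {v : E3 | 0 < f v} := isOpen_lt continuous_const (f_cont f)
  have h2 : IsOpen (Subtype.val '' ((Projectivization.mk' ℝ : {v : E3 // v ≠ 0} → ℙ ℝ E3) ⁻¹' C)) :=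
    (isOpen_ne (x := (0 : E3))).isOpenMap_subtype_val _ (hC.preimage mk'_continuous)
  convert h1.inter h2 using 1
  ext v
  simp only [cone, Set.mem_ofPred_eq, Set.mem_inter_iff, Set.mem_image, Set.mem_preimage,
    Projectivization.mk'_eq_mk, Subtype.exists, exists_and_right, exists_eq_right]

theorem cone_convex (C : Set (ℙ ℝ E3)) (f : E3 →ₗ[ℝ] ℝ)
    (hK : Convex ℝ {w : E3 | f w = 1 ∧ ∃ hw : w ≠ 0, Projectivization.mk ℝ w hw ∈ C}) :
    Convex ℝ (cone C f) := by
  rw [convex_iff_forall_pos]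
  intro v hv w hw a b ha hb _
  exact cone_add C f hK _ _ (cone_smul C f a ha v hv) (cone_smul C f b hb w hw)

theorem mem_closure_cone (C : Set (ℙ ℝ E3)) (f : E3 →ₗ[ℝ] ℝ) (v : E3) (hv : v ≠ 0)
    (hf : 0 < f v) : v ∈ closure (cone C f) ↔ Projectivization.mk ℝ v hv ∈ closure C := by
  constructor
  · intro h
    rw [mem_closure_iff_nhds] at h ⊢
    intro t ht
    rw [nhds_mk, mem_map, nhds_subtype_eq_comap, mem_comap] at ht
    obtain ⟨N, hN, hNt⟩ := ht
    obtain ⟨w, hw, h1, h2, h3⟩ := h N hN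
    exact ⟨_, @hNt ⟨w, h2⟩ hw, h3⟩
  · intro h
    rw [mem_closure_iff]
    intro N hN hvN
    obtain ⟨w, hw, h0, hwC⟩ := exists_mem_of_closure C v hv h (N ∩ {v : E3 | 0 < f v})
      (hN.inter (isOpen_lt continuous_const (f_cont f))) ⟨hvN, hf⟩
    exact ⟨w, hw.1, hw.2, h0, hwC⟩

/-- normalized representative -/
def Gam (f : E3 →ₗ[ℝ] ℝ) (p : ℙ ℝ E3) : E3 := (f p.rep)⁻¹ • p.rep

theorem Gam_mk (f : E3 →ₗ[ℝ] ℝ) (v : E3) (hv : v ≠ 0) :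
    Gam f (Projectivization.mk ℝ v hv) = (f v)⁻¹ • v := by
  obtain ⟨a, ha⟩ := Projectivization.exists_smul_eq_mk_rep ℝ v hv
  rw [Gam, ← ha, Units.smul_def, map_smul, smul_smul, smul_eq_mul, mul_inv, mul_assoc,
    mul_comm, mul_assoc, mul_inv_cancel₀ a.ne_zero, mul_one]

theorem Gam_spec (C : Set (ℙ ℝ E3)) (f : E3 →ₗ[ℝ] ℝ)
    (hf : ∀ (v : E3) (hv : v ≠ 0), Projectivization.mk ℝ v hv ∈ closure C → f v ≠ 0)
    (p : ℙ ℝ E3) (hp : p ∈ closure C) :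
    f (Gam f p) = 1 ∧ ∃ h : Gam f p ≠ 0, p = Projectivization.mk ℝ (Gam f p) h := by
  induction p using Projectivization.ind with | h v hv =>
  have h := hf v hv hp
  have h1 : f (Gam f (Projectivization.mk ℝ v hv)) = 1 := by
    rw [Gam_mk, map_smul, smul_eq_mul, inv_mul_cancel₀ h]
  have h0 : Gam f (Projectivization.mk ℝ v hv) ≠ 0 := by
    intro h0; rw [h0, map_zero] at h1; exact zero_ne_one h1
  refine ⟨h1, h0, ?_⟩
  refine (Projectivization.mk_eq_mk_iff' ℝ _ _ _ _).2 ⟨f v, ?_⟩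
  rw [Gam_mk, smul_smul, mul_inv_cancel₀ h, one_smul]

theorem Gam_contAt (f : E3 →ₗ[ℝ] ℝ) (v : E3) (hv : v ≠ 0) (hf : f v ≠ 0) :
    ContinuousAt (Gam f) (Projectivization.mk ℝ v hv) :=
  continuousAt_of_mk _ (fun v => (f v)⁻¹ • v) v hv (fun w hw => Gam_mk f w hw)
    (((f_cont f).continuousAt.inv₀ hf).smul continuousAt_id)

/-- functional from a plane avoiding the cone -/
theorem exists_functional (Ω : Set E3) (hΩ : Convex ℝ Ω) (o : E3) (ho : o ∈ Ω)
    (W : Submodule ℝ E3) (hW : finrank ℝ W = 2) (hd : ∀ v ∈ Ω, v ∉ W) :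
    ∃ φ : E3 →L[ℝ] ℝ, φ o = 1 ∧ (∀ v ∈ Ω, 0 < φ v) ∧ ∀ v, v ∈ W ↔ φ v = 0 := by
  obtain ⟨g, hgo, hg⟩ := Submodule.exists_le_ker_of_notMem (hd o ho)
  set ψ : E3 →ₗ[ℝ] ℝ := (g o)⁻¹ • g with hψ
  have ho1 : ψ o = 1 := by simp [hψ, hgo]
  have hker : W = LinearMap.ker ψ := by
    apply Submodule.eq_of_le_of_finrank_eq
    · intro v hv
      have : g v = 0 := hg hv
      simp [hψ, this]
    · have h1 := LinearMap.finrank_range_add_finrank_ker ψ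
      have h2 : LinearMap.range ψ = ⊤ := by
        rw [LinearMap.range_eq_top]
        intro c
        exact ⟨c • o, by simp [ho1]⟩
      rw [h2, finrank_top, Module.finrank_self] at h1
      simp at h1
      omega
  have hmem : ∀ v, v ∈ W ↔ ψ v = 0 := fun v => by rw [hker]; rfl
  refine ⟨LinearMap.toContinuousLinearMap ψ, ho1, ?_, hmem⟩
  intro v hv
  by_contra hneg
  have hneg' : ψ v ≤ 0 := not_lt.1 hneg
  have hd1 : 0 < 1 - ψ v := by linarith
  have := hΩ ho hv (a := -ψ v / (1 - ψ v)) (b := 1 / (1 - ψ v))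
    (div_nonneg (by linarith) hd1.le) (div_nonneg one_pos.le hd1.le) (by
      rw [← add_div, neg_add_eq_sub, div_self hd1.ne'])
  apply hd _ this
  rw [hmem, map_add, map_smul, map_smul, ho1, smul_eq_mul, smul_eq_mul]
  field_simp
  ring

theorem norm_bound (Ω : Set E3) (o : E3) (ε : ℝ) (hε : 0 < ε) (hb : Metric.ball o ε ⊆ Ω)
    (φ : E3 →L[ℝ] ℝ) (h1 : φ o = 1) (h2 : ∀ v ∈ Ω, 0 < φ v) : ‖φ‖ ≤ 2 / ε := by
  refine ContinuousLinearMap.opNorm_le_bound _ (by positivity) fun u => ?_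
  by_cases hu : u = 0
  · simp [hu]
  have hn : 0 < ‖u‖ := norm_pos_iff.2 hu
  have key : ∀ s : ℝ, |s| = 1 → -1 < s * (ε / (2 * ‖u‖)) * φ u := by
    intro s hs
    have := h2 (o + (s * (ε / (2 * ‖u‖))) • u) (hb (by
      rw [Metric.mem_ball, dist_eq_norm, add_sub_cancel_left, norm_smul, Real.norm_eq_abs,
        abs_mul, hs, one_mul, abs_of_pos (by positivity)]
      have : ε / (2 * ‖u‖) * ‖u‖ = ε / 2 := by field_simp
      linarith))
    rw [map_add, map_smul, h1, smul_eq_mul] at this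
    linarith
  have k1 := key 1 (by simp)
  have k2 := key (-1) (by simp)
  have k3 : |ε / (2 * ‖u‖) * φ u| ≤ 1 := abs_le.2 ⟨by linarith, by linarith⟩
  rw [abs_mul, abs_of_pos (by positivity)] at k3
  rw [Real.norm_eq_abs]
  have : |φ u| = (2 / ε * ‖u‖) * (ε / (2 * ‖u‖) * |φ u|) := by field_simp
  rw [this]
  exact mul_le_of_le_one_right (by positivity) k3

theorem clusterPt_unique {X : Type*} {l : Filter X} {u : X → ℝ} {a b : ℝ}
    (h : MapClusterPt a l u) (ht : Tendsto u l (𝓝 b)) : a = b := by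
  have h1 : NeBot (𝓝 a ⊓ map u l) := h
  have h2 : NeBot (𝓝 a ⊓ 𝓝 b) := h1.mono (inf_le_inf_left _ ht)
  exact eq_of_nhds_neBot h2

theorem ker_finrank (ψ : E3 →ₗ[ℝ] ℝ) (o : E3) (h : ψ o = 1) :
    finrank ℝ (LinearMap.ker ψ) = 2 := by
  have h1 := LinearMap.finrank_range_add_finrank_ker ψ
  have h2 : LinearMap.range ψ = ⊤ := by
    rw [LinearMap.range_eq_top]
    intro c
    exact ⟨c • o, by simp [h]⟩
  rw [h2, finrank_top, Module.finrank_self, Module.finrank_fin_fun] at h1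
  omega

theorem setup
    (C : Set (ℙ ℝ (Fin 3 → ℝ))) (hCopen : IsOpen C) (hCpc : ProperlyConvex C)
    (hstrict : StrictlyConvexBoundary C)
    (hC1 : ∀ p ∈ frontier C, ∃! W : Submodule ℝ (Fin 3 → ℝ), IsSupportingLineAt C W p)
    (ξ₁ : Circle → ℙ ℝ (Fin 3 → ℝ))
    (hξ₁ : ∃ e : Circle ≃ₜ frontier C, ∀ x, (e x : ℙ ℝ (Fin 3 → ℝ)) = ξ₁ x)
    (ξ₂ : Circle → Submodule ℝ (Fin 3 → ℝ))
    (hξ₂ : ∀ x, IsSupportingLineAt C (ξ₂ x) (ξ₁ x)) :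
    ∃ (γ : Circle → E3) (Φ : Circle → E3 →L[ℝ] ℝ) (f : E3 →ₗ[ℝ] ℝ),
      Continuous Φ ∧ (∀ y v, v ∈ ξ₂ y ↔ Φ y v = 0) ∧
      (∀ y, ∃ h : γ y ≠ 0, ξ₁ y = Projectivization.mk ℝ (γ y) h) ∧
      (∀ y, Φ y (γ y) = 0) ∧
      (∀ y y', y ≠ y' → 0 < Φ y (γ y')) ∧ (∀ y, 0 < f (γ y)) ∧
      (∀ v z, 0 < f v → (∀ y, 0 ≤ Φ y v) → Φ z v = 0 → ∃ c : ℝ, v = c • γ z) := by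
  obtain ⟨f, hf, hK⟩ := hCpc
  obtain ⟨e, he⟩ := hξ₁
  have hfr : ∀ y, ξ₁ y ∈ frontier C := fun y => he y ▸ (e y).2
  have hcl : ∀ y, ξ₁ y ∈ closure C := fun y => frontier_subset_closure (hfr y)
  have hξc : Continuous ξ₁ := by
    rw [show ξ₁ = fun y => (e y : ℙ ℝ E3) from funext fun y => (he y).symm]
    exact continuous_subtype_val.comp e.continuous
  have hinj : Function.Injective ξ₁ := by
    intro a b h
    rw [← he, ← he] at h
    exact e.injective (Subtype.ext h)
  have hsurj : ∀ p ∈ frontier C, ∃ y, ξ₁ y = p := by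
    intro p hp
    obtain ⟨y, hy⟩ := e.surjective ⟨p, hp⟩
    exact ⟨y, by rw [← he, hy]⟩
  set Ω := cone C f with hΩdef
  have hΩo : IsOpen Ω := cone_open C hCopen f
  have hΩc : Convex ℝ Ω := cone_convex C f hK
  -- a base point
  obtain ⟨p₀, hp₀⟩ : C.Nonempty := closure_nonempty_iff.1 ⟨_, hcl 1⟩
  obtain ⟨ho1, ho0, hoe⟩ := Gam_spec C f hf p₀ (subset_closure hp₀)
  set o := Gam f p₀ with ho_def
  have ho : o ∈ Ω := ⟨by rw [ho1]; exact one_pos, ho0, hoe ▸ hp₀⟩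
  set γ : Circle → E3 := fun y => Gam f (ξ₁ y) with hγ
  have hγ1 : ∀ y, f (γ y) = 1 := fun y => (Gam_spec C f hf _ (hcl y)).1
  have hγ2 : ∀ y, ∃ h : γ y ≠ 0, ξ₁ y = Projectivization.mk ℝ (γ y) h :=
    fun y => (Gam_spec C f hf _ (hcl y)).2
  have hγc : Continuous γ := by
    rw [continuous_iff_continuousAt]
    intro y
    obtain ⟨h0, hy⟩ := hγ2 y
    refine ContinuousAt.comp (g := Gam f) ?_ hξc.continuousAt
    rw [hy]
    exact Gam_contAt f _ h0 (by rw [hγ1]; exact one_ne_zero)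
  have hγcl : ∀ y, γ y ∈ closure Ω := by
    intro y
    obtain ⟨h0, hy⟩ := hγ2 y
    rw [mem_closure_cone C f _ h0 (by rw [hγ1]; exact one_pos), ← hy]
    exact hcl y
  -- functionals
  have hex : ∀ y, ∃ φ : E3 →L[ℝ] ℝ, φ o = 1 ∧ (∀ v ∈ Ω, 0 < φ v) ∧
      ∀ v, v ∈ ξ₂ y ↔ φ v = 0 := by
    intro y
    obtain ⟨h1, h2, h3, h4⟩ := hξ₂ y
    refine exists_functional Ω hΩc o ho _ h1 ?_
    rintro v ⟨_, hv0, hvC⟩ hvW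
    have : Projectivization.mk ℝ v hv0 ∈ projLine (ξ₂ y) ∩ C := by
      refine ⟨?_, hvC⟩
      rw [projLine, Set.mem_ofPred_eq, Projectivization.submodule_mk,
        Submodule.span_singleton_le_iff_mem]
      exact hvW
    rw [h4] at this
    exact this
  choose Φ hΦo hΦpos hΦmem using hex
  have hΦγ : ∀ y, Φ y (γ y) = 0 := by
    intro y
    rw [← hΦmem]
    obtain ⟨h0, hy⟩ := hγ2 y
    have := (hξ₂ y).2.2.1
    rw [hy, Projectivization.submodule_mk, Submodule.span_singleton_le_iff_mem] at this
    exact this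
  have hclpos : ∀ y, ∀ v ∈ closure Ω, 0 ≤ Φ y v := by
    intro y v hv
    exact closure_minimal (fun w hw => (hΦpos y w hw).le)
      (isClosed_le continuous_const (Φ y).continuous) hv
  -- a point of closure Ω with `Φ y v = 0`, `f v > 0` is in frontier
  have hfront : ∀ y v (hv0 : v ≠ 0), v ∈ closure Ω → 0 < f v → Φ y v = 0 →
      Projectivization.mk ℝ v hv0 ∈ frontier C := by
    intro y v hv0 hv hfv hy
    rw [frontier, hCopen.interior_eq]
    refine ⟨(mem_closure_cone C f v hv0 hfv).1 hv, fun h => ?_⟩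
    exact (hΦpos y v ⟨hfv, hv0, h⟩).ne' hy
  have hne0 : ∀ v, 0 < f v → v ≠ 0 := by
    rintro v hv rfl
    simp at hv
  have hstr : ∀ y y', y ≠ y' → 0 < Φ y (γ y') := by
    intro y y' hyy
    refine lt_of_le_of_ne (hclpos y _ (hγcl y')) (fun h0 => ?_)
    have hm : (1 / 2 : ℝ) • γ y + (1 / 2 : ℝ) • γ y' ∈ closure Ω :=
      hΩc.closure (hγcl y) (hγcl y') (by norm_num) (by norm_num) (by norm_num)
    have hfm : f ((1 / 2 : ℝ) • γ y + (1 / 2 : ℝ) • γ y') = 1 := by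
      rw [map_add, map_smul, map_smul, hγ1, hγ1]; norm_num
    have hΦm : Φ y ((1 / 2 : ℝ) • γ y + (1 / 2 : ℝ) • γ y') = 0 := by
      rw [map_add, map_smul, map_smul, hΦγ, ← h0]; norm_num
    have hm0 := hne0 _ (by rw [hfm]; exact one_pos)
    have hmf := hfront y _ hm0 hm (by rw [hfm]; exact one_pos) hΦm
    obtain ⟨a0, ha⟩ := hγ2 y
    obtain ⟨b0, hb⟩ := hγ2 y'
    have hGm : Gam f (Projectivization.mk ℝ _ hm0) = (1 / 2 : ℝ) • γ y + (1 / 2 : ℝ) • γ y' := by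
      rw [Gam_mk, hfm, inv_one, one_smul]
    have hγne : γ y ≠ γ y' := by
      intro h
      apply hyy
      apply hinj
      rw [ha, hb]
      congr 1
    refine hstrict (ξ₁ y) (ξ₁ y') _ (hfr y) (hfr y') hmf (hinj.ne hyy) ?_ ?_ (ξ₂ y) (hξ₂ y).1
      ⟨(hξ₂ y).2.2.1, ?_, ?_⟩
    · intro h
      rw [← h] at hGm
      change γ y = _ at hGm
      apply hγne
      ext i
      have := congrFun hGm i
      simp at this
      linarith
    · intro h
      rw [← h] at hGm
      change γ y' = _ at hGm
      apply hγne
      ext i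
      have := congrFun hGm i
      simp at this
      linarith
    · rw [hb, Projectivization.submodule_mk, Submodule.span_singleton_le_iff_mem, hΦmem, ← h0]
    · rw [Projectivization.submodule_mk, Submodule.span_singleton_le_iff_mem, hΦmem, hΦm]
  -- uniqueness
  have huniq : ∀ y (ψ : E3 →L[ℝ] ℝ), ψ o = 1 → (∀ v ∈ Ω, 0 ≤ ψ v) → ψ (γ y) = 0 → ψ = Φ y := by
    intro y ψ h1 h2 h3
    have hpos : ∀ v ∈ Ω, ψ v ≠ 0 := by
      intro v hv h0
      have hcont : Continuous fun s : ℝ => v - s • o := by fun_prop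
      have hnear : ∀ᶠ s in 𝓝[>] (0 : ℝ), v - s • o ∈ Ω := by
        apply nhdsWithin_le_nhds
        apply hcont.continuousAt
        apply hΩo.mem_nhds
        simpa using hv
      obtain ⟨s, hs, hs0⟩ := (hnear.and self_mem_nhdsWithin).exists
      have := h2 _ hs
      rw [map_sub, map_smul, h0, h1, smul_eq_mul] at this
      have hs0' : 0 < s := hs0
      linarith
    have hsup : IsSupportingLineAt C (LinearMap.ker (ψ : E3 →ₗ[ℝ] ℝ)) (ξ₁ y) := by
      refine ⟨?_, hfr y, ?_, ?_⟩
      · exact ker_finrank _ o h1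
      · obtain ⟨h0, hy⟩ := hγ2 y
        rw [hy, Projectivization.submodule_mk, Submodule.span_singleton_le_iff_mem]
        exact h3
      · rw [Set.eq_empty_iff_forall_notMem]
        rintro p ⟨hp, hpC⟩
        obtain ⟨hp1, hp0, hpe⟩ := Gam_spec C f hf p (subset_closure hpC)
        rw [projLine, Set.mem_ofPred_eq, hpe, Projectivization.submodule_mk,
          Submodule.span_singleton_le_iff_mem] at hp
        exact hpos _ ⟨by rw [hp1]; exact one_pos, hp0, hpe ▸ hpC⟩ hp
    have hW := (hC1 _ (hfr y)).unique hsup (hξ₂ y)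
    ext1 v
    have hv : v - ψ v • o ∈ ξ₂ y := by
      rw [← hW]
      simp [h1]
    rw [hΦmem, map_sub, map_smul, hΦo, smul_eq_mul, mul_one] at hv
    linarith
  -- continuity
  obtain ⟨ε, hε, hball⟩ := Metric.isOpen_iff.1 hΩo o ho
  have hbd : ∀ y, ‖Φ y‖ ≤ 2 / ε := fun y => norm_bound Ω o ε hε hball _ (hΦo y) (hΦpos y)
  have hΦc : Continuous Φ := by
    rw [continuous_iff_continuousAt]
    intro y
    have : ProperSpace (E3 →L[ℝ] ℝ) := FiniteDimensional.proper ℝ _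
    refine (isCompact_closedBall (0 : E3 →L[ℝ] ℝ) (2 / ε)).tendsto_nhds_of_unique_mapClusterPt
      (Eventually.of_forall fun y' => by simpa using hbd y') ?_
    intro ψ _ hψ
    have hev : ∀ v : E3, MapClusterPt (ψ v) (𝓝 y) (fun y' => Φ y' v) := by
      intro v
      have hcv : Continuous fun φ : E3 →L[ℝ] ℝ => φ v := by fun_prop
      exact hψ.tendsto_comp hcv.continuousAt
    refine huniq y ψ ?_ ?_ ?_
    · have h := hev o
      simp only [hΦo] at h
      exact clusterPt_unique h tendsto_const_nhds
    · intro v hv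
      exact isClosed_Ici.mem_of_mapClusterPt (hev v) (Eventually.of_forall fun y' =>
        (hΦpos y' v hv).le)
    · have h := hev (γ y)
      have ht : Tendsto (fun y' => Φ y' (γ y)) (𝓝 y) (𝓝 0) := by
        refine squeeze_zero_norm (a := fun y' => 2 / ε * ‖γ y - γ y'‖) ?_ ?_
        · intro y'
          have : Φ y' (γ y) = Φ y' (γ y - γ y') := by rw [map_sub, hΦγ, sub_zero]
          rw [this]
          exact (Φ y').le_of_opNorm_le (hbd y') _
        · have : Continuous fun y' => 2 / ε * ‖γ y - γ y'‖ := by fun_prop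
          have := this.tendsto y
          simpa using this
      exact clusterPt_unique h ht
  refine ⟨γ, Φ, f, hΦc, hΦmem, hγ2, hΦγ, hstr, fun y => by rw [hγ1]; exact one_pos, ?_⟩
  -- final property
  intro v z hfv hv hz
  have hv0 := hne0 v hfv
  have hvcl : Projectivization.mk ℝ v hv0 ∈ closure C := by
    by_contra hnot
    set g : ℝ → E3 := fun s => (1 - s) • o + s • v with hg
    have hgf : ∀ s ∈ Set.Icc (0 : ℝ) 1, 0 < f (g s) := by
      rintro s ⟨hs0, hs1⟩
      rw [hg]
      simp only [map_add, map_smul, ho1, smul_eq_mul, mul_one]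
      rcases hs1.lt_or_eq with h | h
      · have := mul_nonneg hs0 hfv.le
        linarith
      · rw [h]; linarith
    have hgc : Continuous fun s : Set.Icc (0 : ℝ) 1 => Projectivization.mk ℝ (g s)
        (hne0 _ (hgf s s.2)) := continuous_mk_comp _ (by fun_prop) _
    set G := fun s : Set.Icc (0 : ℝ) 1 => Projectivization.mk ℝ (g s) (hne0 _ (hgf s s.2)) with hG
    have hne : (frontier (G ⁻¹' C)).Nonempty := by
      rw [nonempty_frontier_iff]
      constructor
      · refine ⟨⟨0, by simp⟩, ?_⟩
        simp only [hG, hg, Set.mem_preimage]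
        simp only [sub_zero, one_smul, zero_smul, add_zero]
        exact hoe ▸ hp₀
      · intro h
        have : (⟨1, by simp⟩ : Set.Icc (0 : ℝ) 1) ∈ G ⁻¹' C := by rw [h]; trivial
        simp only [hG, hg, Set.mem_preimage] at this
        simp only [sub_self, one_smul, zero_smul, zero_add] at this
        exact hnot (subset_closure this)
    obtain ⟨s, hs⟩ := hne
    have hsC : G s ∈ frontier C := hgc.frontier_preimage_subset C hs
    obtain ⟨y, hy⟩ := hsurj _ hsC
    have hmem : g s ∈ ξ₂ y := by
      have := (hξ₂ y).2.2.1
      rw [hy, hG, Projectivization.submodule_mk, Submodule.span_singleton_le_iff_mem] at this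
      exact this
    rw [hΦmem, hg] at hmem
    simp only [map_add, map_smul, hΦo, smul_eq_mul, mul_one] at hmem
    have h1 := mul_nonneg s.2.1 (hv y)
    have h2 := s.2.2
    have hs1 : (s : ℝ) = 1 := by linarith
    apply hnot
    have : G s = Projectivization.mk ℝ v hv0 := by
      simp only [hG, hg]
      congr 1
      rw [hs1]; simp
    rw [← this]
    exact frontier_subset_closure hsC
  have hvf := hfront z v hv0 ((mem_closure_cone C f v hv0 hfv).2 hvcl) hfv hz
  obtain ⟨y, hy⟩ := hsurj _ hvf
  obtain ⟨h0, hy'⟩ := hγ2 y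
  rw [hy'] at hy
  obtain ⟨c, hc⟩ := (Projectivization.mk_eq_mk_iff' ℝ _ _ _ _).1 hy.symm
  by_cases hyz : y = z
  · exact ⟨c, by rw [← hyz, hc]⟩
  · exfalso
    have h1 := hstr z y (Ne.symm hyz)
    rw [← hc, map_smul, smul_eq_mul] at hz
    rcases mul_eq_zero.1 hz with h | h
    · apply hv0; rw [← hc, h, zero_smul]
    · exact h1.ne' h

theorem clm_sum (φ : E3 →L[ℝ] ℝ) (v : E3) :
    φ v = φ (Pi.single 0 1) * v 0 + φ (Pi.single 1 1) * v 1 + φ (Pi.single 2 1) * v 2 := by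
  conv_lhs => rw [pi_eq_sum_univ' v]
  simp only [Fin.sum_univ_three, map_add, map_smul, smul_eq_mul]
  ring

theorem three_tangents (φ₀ φ₁ φ₂ : E3 →L[ℝ] ℝ) (g₀ g₁ g₂ p : E3)
    (h00 : φ₀ g₀ = 0) (h11 : φ₁ g₁ = 0) (h22 : φ₂ g₂ = 0)
    (h01 : 0 < φ₀ g₁) (h02 : 0 < φ₀ g₂) (h10 : 0 < φ₁ g₀) (h12 : 0 < φ₁ g₂)
    (h20 : 0 < φ₂ g₀) (h21 : 0 < φ₂ g₁)
    (hp0 : φ₀ p = 0) (hp1 : φ₁ p = 0) (hp2 : φ₂ p = 0) : p = 0 := by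
  let A : Matrix (Fin 3) (Fin 3) ℝ := fun i j => (![φ₀, φ₁, φ₂] i) (Pi.single j 1)
  let B : Matrix (Fin 3) (Fin 3) ℝ := fun j k => (![g₀, g₁, g₂] k) j
  have hAB : A * B = !![0, φ₀ g₁, φ₀ g₂; φ₁ g₀, 0, φ₁ g₂; φ₂ g₀, φ₂ g₁, 0] := by
    ext i k
    rw [Matrix.mul_apply, Fin.sum_univ_three]
    simp only [A, B]
    rw [← clm_sum]
    fin_cases i <;> fin_cases k <;> simp [h00, h11, h22]
  have hdet : A.det ≠ 0 := by
    intro h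
    have h1 : (A * B).det = 0 := by rw [Matrix.det_mul, h, zero_mul]
    rw [hAB, Matrix.det_fin_three] at h1
    simp at h1
    have h3 := mul_pos (mul_pos h01 h12) h20
    have h4 := mul_pos (mul_pos h02 h10) h21
    linarith
  apply Matrix.eq_zero_of_mulVec_eq_zero hdet
  ext i
  rw [Matrix.mulVec, dotProduct, Fin.sum_univ_three]
  simp only [A]
  rw [← clm_sum]
  fin_cases i <;> simp [hp0, hp1, hp2]

/-- For distinct `x, z`: the points `ξ¹(z)` and `q = ℙ(ξ²(x) ∩ ξ²(z))` of the
projective line `ℙ(ξ²(z))` are distinct, `ℙ(ξ²(z)) ∖ {ξ¹(z), q}` has exactly two connected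
components, and `y ↦ ℙ(ξ²(y) ∩ ξ²(z))` restricts to homeomorphisms from the two open arcs
bounded by `x` and `z` onto the two components. -/
theorem statement_4
    (C : Set (ℙ ℝ (Fin 3 → ℝ))) (hCopen : IsOpen C) (hCpc : ProperlyConvex C)
    (hstrict : StrictlyConvexBoundary C)
    (hC1 : ∀ p ∈ frontier C, ∃! W : Submodule ℝ (Fin 3 → ℝ), IsSupportingLineAt C W p)
    (ξ₁ : Circle → ℙ ℝ (Fin 3 → ℝ))
    (hξ₁ : ∃ e : Circle ≃ₜ frontier C, ∀ x, (e x : ℙ ℝ (Fin 3 → ℝ)) = ξ₁ x)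
    (ξ₂ : Circle → Submodule ℝ (Fin 3 → ℝ))
    (hξ₂ : ∀ x, IsSupportingLineAt C (ξ₂ x) (ξ₁ x))
    (x z : Circle) (hxz : x ≠ z) :
    ∃ q : ℙ ℝ (Fin 3 → ℝ), q.submodule = ξ₂ x ⊓ ξ₂ z ∧ q ≠ ξ₁ z ∧
    ∃ U V : Set (ℙ ℝ (Fin 3 → ℝ)), U ≠ V ∧
      (∃ p ∈ projLine (ξ₂ z) \ {ξ₁ z, q},
        connectedComponentIn (projLine (ξ₂ z) \ {ξ₁ z, q}) p = U) ∧
      (∃ p ∈ projLine (ξ₂ z) \ {ξ₁ z, q},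
        connectedComponentIn (projLine (ξ₂ z) \ {ξ₁ z, q}) p = V) ∧
      (∀ p ∈ projLine (ξ₂ z) \ {ξ₁ z, q},
        connectedComponentIn (projLine (ξ₂ z) \ {ξ₁ z, q}) p = U ∨
        connectedComponentIn (projLine (ξ₂ z) \ {ξ₁ z, q}) p = V) ∧
      ∃ η : Circle → ℙ ℝ (Fin 3 → ℝ),
        (∀ y, y ≠ z → (η y).submodule = ξ₂ y ⊓ ξ₂ z) ∧
        (∃ e : {y : Circle // PosOriented x y z} ≃ₜ ↥U,
          ∀ a, (e a : ℙ ℝ (Fin 3 → ℝ)) = η ↑a) ∧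
        (∃ e : {y : Circle // PosOriented z y x} ≃ₜ ↥V,
          ∀ a, (e a : ℙ ℝ (Fin 3 → ℝ)) = η ↑a) := by
  obtain ⟨γ, Φ, f, hΦc, hΦmem, hγ2, hΦγ, hstr, hfγ, hfin⟩ :=
    setup C hCopen hCpc hstrict hC1 ξ₁ hξ₁ ξ₂ hξ₂
  set a := γ z with ha
  obtain ⟨ha0, hza⟩ := hγ2 z
  have hΦa : ∀ y, y ≠ z → 0 < Φ y a := fun y hy => hstr y z hy
  have hza0 : Φ z a = 0 := hΦγ z
  have hxa := hΦa x hxz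
  obtain ⟨b, hb, hb0⟩ : ∃ b ∈ ξ₂ x ⊓ ξ₂ z, b ≠ 0 := by
    apply Submodule.exists_mem_ne_zero_of_ne_bot
    intro h
    have h1 := Submodule.finrank_sup_add_finrank_inf_eq (ξ₂ x) (ξ₂ z)
    have h2 := Submodule.finrank_le (ξ₂ x ⊔ ξ₂ z)
    rw [h, finrank_bot, (hξ₂ x).1, (hξ₂ z).1] at h1
    simp at h2
    omega
  have hxb : Φ x b = 0 := (hΦmem x b).1 hb.1
  have hzb : Φ z b = 0 := (hΦmem z b).1 hb.2
  obtain ⟨β, hβb, hβ⟩ := Submodule.exists_le_ker_of_notMem (p := Submodule.span ℝ {a}) (v := b)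
    (by
      intro h
      obtain ⟨c, rfl⟩ := Submodule.mem_span_singleton.1 h
      rw [map_smul, smul_eq_mul] at hxb
      rcases mul_eq_zero.1 hxb with h | h
      · apply hb0; rw [h, zero_smul]
      · exact hxa.ne' h)
  have hβa : β a = 0 := hβ (Submodule.mem_span_singleton_self a)
  have hspan : ∀ v ∈ ξ₂ z, ∃ s t : ℝ, v = s • a + t • b := by
    intro v hv
    have hli : LinearIndependent ℝ ![a, b] := by
      rw [LinearIndependent.pair_iff]
      intro s t hst
      have h1 : t = 0 := by
        have := congrArg β hst
        simpa [hβa, hβb] using this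
      refine ⟨?_, h1⟩
      have := congrArg (Φ x) hst
      simpa [hxb, hxa.ne'] using this
    have heq : Submodule.span ℝ (Set.range ![a, b]) = ξ₂ z := by
      apply Submodule.eq_of_le_of_finrank_eq
      · rw [Submodule.span_le]
        rintro _ ⟨i, rfl⟩
        fin_cases i
        · exact (hΦmem z a).2 hza0
        · exact hb.2
      · rw [finrank_span_eq_card hli, (hξ₂ z).1]; simp
    rw [← heq] at hv
    simp only [Matrix.range_cons, Matrix.range_empty, Set.union_empty, Set.singleton_union] at hv
    obtain ⟨s, t, h⟩ := Submodule.mem_span_pair.1 hv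
    exact ⟨s, t, h.symm⟩
  -- the map η
  have hnv : ∀ y, y ≠ z → Φ y b • a - Φ y a • b ≠ 0 := by
    intro y hy h
    have := congrArg β h
    simp [hβa, hβb, (hΦa y hy).ne'] at this
  classical
  let η : Circle → ℙ ℝ (Fin 3 → ℝ) := fun y =>
    if h : y = z then ξ₁ z else Projectivization.mk ℝ _ (hnv y h)
  have hη : ∀ y (h : y ≠ z), η y = Projectivization.mk ℝ _ (hnv y h) := fun y h => dif_neg h
  have hηs : ∀ y, y ≠ z → (η y).submodule = ξ₂ y ⊓ ξ₂ z := by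
    intro y hy
    rw [hη y hy, Projectivization.submodule_mk]
    apply le_antisymm
    · rw [Submodule.span_singleton_le_iff_mem, Submodule.mem_inf, hΦmem, hΦmem]
      simp only [map_sub, map_smul, smul_eq_mul, hza0, hzb]
      exact ⟨by ring, by ring⟩
    · rintro v ⟨hv1, hv2⟩
      obtain ⟨s, t, rfl⟩ := hspan v hv2
      have h1 := (hΦmem y _).1 hv1
      simp only [map_add, map_smul, smul_eq_mul] at h1
      rw [Submodule.mem_span_singleton]
      have hp := (hΦa y hy).ne'
      refine ⟨-(t / Φ y a), ?_⟩
      rw [smul_sub, smul_smul, smul_smul, sub_eq_add_neg, ← neg_smul]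
      congr 2
      · field_simp; linarith
      · field_simp
  -- affine parametrization of the line
  have hL0 : ∀ s : ℝ, s • a - b ≠ 0 := by
    intro s h
    have := congrArg β h
    simp [hβa, hβb] at this
  let L : ℝ → ℙ ℝ (Fin 3 → ℝ) := fun s => Projectivization.mk ℝ (s • a - b) (hL0 s)
  have hLc : Continuous L := continuous_mk_comp _ (by fun_prop) _
  have hLe : IsEmbedding L := by
    have hr : ∀ w (hw : w ≠ 0), (fun p : ℙ ℝ E3 => -(β b / Φ x a) * (Φ x p.rep / β p.rep))
        (Projectivization.mk ℝ w hw) = -(β b / Φ x a) * (Φ x w / β w) := by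
      intro w hw
      obtain ⟨c, hc⟩ := Projectivization.exists_smul_eq_mk_rep ℝ w hw
      simp only [← hc, Units.smul_def, map_smul, smul_eq_mul]
      rw [mul_div_mul_left _ _ c.ne_zero]
    refine inducing_of_left L (hf := hLc) (hgf := fun s => ?_) (hg := fun s => ?_) (g := fun p : ℙ ℝ E3 =>
      -(β b / Φ x a) * (Φ x p.rep / β p.rep))
    · refine (hr _ (hL0 s)).trans ?_
      simp only [map_sub, map_smul, smul_eq_mul, hxb, hβa, mul_zero, sub_zero, zero_sub]
      have := hxa.ne'
      field_simp
    · refine continuousAt_of_mk _ _ _ (hL0 s) hr ?_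
      refine continuousAt_const.mul (ContinuousAt.div (Φ x).continuous.continuousAt
        (f_cont β).continuousAt ?_)
      simp [hβa, hβb]
  -- the coordinate
  let k : ℝ → ℝ := fun t => Φ (Dp z t) b / Φ (Dp z t) a
  have hka : ∀ t, 0 < Φ (Dp z t) a := fun t => hΦa _ (Dp_ne z t)
  have hΦD : Continuous fun t => Φ (Dp z t) := hΦc.comp (Dp_continuous z)
  have hkc : Continuous k :=
    (hΦD.clm_apply continuous_const).div (hΦD.clm_apply continuous_const) fun t => (hka t).ne'
  have hkp : ∀ t s, k t = s ↔ Φ (Dp z t) (b - s • a) = 0 := by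
    intro t s
    simp only [k]
    rw [div_eq_iff (hka t).ne', map_sub, map_smul, smul_eq_mul, sub_eq_zero]
  have hzp : ∀ s : ℝ, Φ z (b - s • a) = 0 := by
    intro s; rw [map_sub, map_smul, hza0, hzb]; simp
  have hki : Function.Injective k := by
    intro t t' htt
    by_contra hne
    have hy : Dp z t ≠ Dp z t' := (Dp_embedding z).injective.ne hne
    have h1 := (hkp t (k t')).1 htt
    have h2 := (hkp t' (k t')).1 rfl
    have h3 := hzp (k t')
    have := three_tangents (Φ z) (Φ (Dp z t)) (Φ (Dp z t')) a (γ (Dp z t)) (γ (Dp z t')) _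
      hza0 (hΦγ _) (hΦγ _) (hstr _ _ (Dp_ne z t).symm) (hstr _ _ (Dp_ne z t').symm)
      (hka t) (hstr _ _ hy) (hka t') (hstr _ _ hy.symm) h3 h1 h2
    apply hL0 (k t')
    rw [← neg_sub, this, neg_zero]
  have hks : Function.Surjective k := by
    intro s
    by_contra hno
    have hne : ∀ t, Φ (Dp z t) (b - s • a) ≠ 0 := fun t h => hno ⟨t, (hkp t s).2 h⟩
    have hpc : Continuous fun t => Φ (Dp z t) (b - s • a) := hΦD.clm_apply continuous_const
    obtain ⟨σ, hσ0, hσ⟩ : ∃ σ : ℝ, σ ≠ 0 ∧ ∀ t, 0 < σ * Φ (Dp z t) (b - s • a) := by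
      by_cases h0 : 0 < Φ (Dp z 0) (b - s • a)
      · refine ⟨1, one_ne_zero, fun t => ?_⟩
        by_contra hcon
        rw [one_mul, not_lt] at hcon
        obtain ⟨u, hu⟩ := mem_range_of_exists_le_of_exists_ge hpc ⟨t, hcon⟩ ⟨0, h0.le⟩
        exact hne u hu
      · refine ⟨-1, by norm_num, fun t => ?_⟩
        by_contra hcon
        have hcon' : 0 ≤ Φ (Dp z t) (b - s • a) := by linarith
        obtain ⟨u, hu⟩ := mem_range_of_exists_le_of_exists_ge hpc ⟨0, not_lt.1 h0⟩ ⟨t, hcon'⟩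
        exact hne u hu
    have hcont : Continuous fun ε : ℝ => f (a + (ε * σ) • (b - s • a)) :=
      (f_cont f).comp (by fun_prop)
    have hnear : ∀ᶠ ε in 𝓝[>] (0 : ℝ), 0 < f (a + (ε * σ) • (b - s • a)) := by
      apply nhdsWithin_le_nhds
      apply hcont.continuousAt.eventually_mem
      apply isOpen_Ioi.mem_nhds
      simpa using hfγ z
    obtain ⟨ε, hε, hε0⟩ := (hnear.and self_mem_nhdsWithin).exists
    have hε0' : 0 < ε := hε0
    obtain ⟨c, hc⟩ := hfin _ z hε (fun y => by
      by_cases hy : y = z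
      · rw [hy, map_add, map_smul, hzp, hza0]; simp
      · obtain ⟨t, rfl⟩ := exists_Dp_of_ne z y hy
        rw [map_add, map_smul, smul_eq_mul, mul_assoc]
        exact (add_pos (hka t) (mul_pos hε0' (hσ t))).le) (by
      rw [map_add, map_smul, hzp, hza0]; simp)
    have := congrArg β hc
    simp [← ha, hβa, hβb, hσ0, hε0'.ne'] at this
  have hke := embedding_real k hkc hki hks
  let M : ℝ → ℙ ℝ (Fin 3 → ℝ) := L ∘ k
  have hMe : IsEmbedding M := hLe.comp hke
  have hηM : ∀ t, η (Dp z t) = M t := by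
    intro t
    rw [hη _ (Dp_ne z t)]
    refine (Projectivization.mk_eq_mk_iff' ℝ _ _ _ _).2 ⟨Φ (Dp z t) a, ?_⟩
    have := (hka t).ne'
    rw [smul_sub, smul_smul]
    simp only [k]
    rw [mul_div_cancel₀ _ this]
  obtain ⟨t₀, ht₀⟩ := exists_Dp_of_ne z x hxz
  have hqM : η x = M t₀ := by rw [← ht₀, hηM]
  have hMne : ∀ t, M t ≠ ξ₁ z := by
    intro t h
    rw [hza] at h
    obtain ⟨c, hc⟩ := (Projectivization.mk_eq_mk_iff' ℝ _ _ _ _).1 h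
    have := congrArg β hc
    simp [← ha, hβa, hβb] at this
  have hS : projLine (ξ₂ z) \ {ξ₁ z, η x} = M '' {t₀}ᶜ := by
    ext p
    constructor
    · rintro ⟨hp, hpn⟩
      induction p using Projectivization.ind with | h v hv =>
      rw [projLine, Set.mem_ofPred_eq, Projectivization.submodule_mk,
        Submodule.span_singleton_le_iff_mem] at hp
      obtain ⟨s, t, rfl⟩ := hspan v hp
      have ht : t ≠ 0 := by
        rintro rfl
        apply hpn
        left
        rw [hza]
        exact (Projectivization.mk_eq_mk_iff' ℝ _ _ _ _).2 ⟨s, by simp [ha]⟩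
      obtain ⟨u, hu⟩ := hks (-(s / t))
      have hpu : Projectivization.mk ℝ (s • a + t • b) hv = M u := by
        refine (Projectivization.mk_eq_mk_iff' ℝ _ _ _ _).2 ⟨-t, ?_⟩
        rw [hu, smul_sub, smul_smul, sub_eq_add_neg, ← neg_smul]
        congr 2
        · field_simp
        · ring
      refine ⟨u, ?_, hpu.symm⟩
      rintro rfl
      apply hpn
      right
      rw [hpu, ← hqM]; rfl
    · rintro ⟨t, ht, rfl⟩
      refine ⟨?_, ?_⟩
      · change (Projectivization.mk ℝ (k t • a - b) (hL0 _)).submodule ≤ ξ₂ z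
        rw [Projectivization.submodule_mk, Submodule.span_singleton_le_iff_mem, hΦmem, map_sub,
          map_smul, hza0, hzb]
        simp
      · rintro (h | h)
        · exact hMne t h
        · rw [Set.mem_singleton_iff, hqM] at h
          exact ht (hMe.injective h)
  refine ⟨η x, hηs x hxz, by rw [hqM]; exact hMne t₀, M '' Set.Ioi t₀, M '' Set.Iio t₀, ?_, ?_⟩
  · intro h
    have h1 : M (t₀ + 1) ∈ M '' Set.Ioi t₀ := ⟨_, by simp, rfl⟩
    rw [h] at h1
    obtain ⟨u, hu, hu2⟩ := h1
    have h3 := hMe.injective hu2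
    have h4 : u < t₀ := hu
    linarith
  rw [hS]
  refine ⟨⟨M (t₀ + 1), ⟨t₀ + 1, by simp, rfl⟩, comp_Ioi M hMe _ _ (by linarith)⟩,
    ⟨M (t₀ - 1), ⟨t₀ - 1, by simp, rfl⟩, comp_Iio M hMe _ _ (by linarith)⟩, ?_, η, hηs, ?_, ?_⟩
  · rintro p ⟨t, ht, rfl⟩
    rcases lt_or_gt_of_ne (show t ≠ t₀ from ht) with h | h
    · right; exact comp_Iio M hMe _ _ h
    · left; exact comp_Ioi M hMe _ _ h
  · exact exists_homeo (Dp z) M (Dp_embedding z) hMe η hηM _ _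
      fun y => by rw [← ht₀]; exact posOriented_iff₁ z y t₀
  · exact exists_homeo (Dp z) M (Dp_embedding z) hMe η hηM _ _
      fun y => by rw [← ht₀]; exact posOriented_iff₂ z y t₀

end CFF
end
end

section
/- Let (y_n) and (z_n) be sequences in S¹ with y_n ≠ z_n for every n, and suppose both sequences converge to the same point a ∈ S¹. Then the sequence of points ℙ(ξ²(y_n) ∩ ξ²(z_n)) (the 1-dimensional subspaces obtained by intersecting the two tangent planes) converges to ξ¹(a) in ℙ(ℝ³). -/
noncomputable section

open Filter Topology Module
open scoped LinearAlgebra.Projectivization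

namespace CFF

abbrev V3 := Fin 3 → ℝ

def aff (f : V3 →ₗ[ℝ] ℝ) (C : Set (ℙ ℝ V3)) : Set V3 :=
  {w : Fin 3 → ℝ | f w = 1 ∧ ∃ hw : w ≠ 0, Projectivization.mk ℝ w hw ∈ C}

def sig (f : V3 →ₗ[ℝ] ℝ) (p : ℙ ℝ V3) : V3 := (f p.rep)⁻¹ • p.rep

lemma mk_smul_eq_s5 (v : V3) (hv : v ≠ 0) (a : ℝ) (h : a • v ≠ 0) :
    Projectivization.mk ℝ (a • v) h = Projectivization.mk ℝ v hv :=
  (Projectivization.mk_eq_mk_iff' ℝ _ _ _ _).2 ⟨a, rfl⟩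

lemma oq : IsOpenQuotientMap (Projectivization.mk' ℝ : {v : V3 // v ≠ 0} → ℙ ℝ V3) := by
  have hc : Continuous (Projectivization.mk' ℝ : {v : V3 // v ≠ 0} → ℙ ℝ V3) :=
    continuous_quotient_mk'
  refine ⟨fun p => ⟨⟨p.rep, p.rep_nonzero⟩, p.mk_rep⟩, hc, ?_⟩
  intro O hO
  have hq : IsOpen ((Projectivization.mk' ℝ : {v : V3 // v ≠ 0} → ℙ ℝ V3) ⁻¹'
      ((Projectivization.mk' ℝ) '' O)) := by
    have : ((Projectivization.mk' ℝ : {v : V3 // v ≠ 0} → ℙ ℝ V3) ⁻¹'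
      ((Projectivization.mk' ℝ) '' O)) = ⋃ a : ℝˣ, {w : {v : V3 // v ≠ 0} |
        (⟨a • w.1, (smul_ne_zero_iff_ne a).2 w.2⟩ : {v : V3 // v ≠ 0}) ∈ O} := by
      ext w
      simp only [Set.mem_preimage, Set.mem_image, Set.mem_iUnion, Set.mem_ofPred_eq]
      constructor
      · rintro ⟨v, hv, h⟩
        rw [Projectivization.mk'_eq_mk, Projectivization.mk'_eq_mk,
          Projectivization.mk_eq_mk_iff] at h
        obtain ⟨a, ha⟩ := h
        refine ⟨a, ?_⟩
        convert hv
      · rintro ⟨a, ha⟩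
        refine ⟨_, ha, ?_⟩
        rw [Projectivization.mk'_eq_mk, Projectivization.mk'_eq_mk,
          Projectivization.mk_eq_mk_iff]
        exact ⟨a, rfl⟩
    rw [this]
    refine isOpen_iUnion fun a => hO.preimage ?_
    refine Continuous.subtype_mk ?_ _
    exact continuous_subtype_val.const_smul _
  exact hq

lemma sig_mk (f : V3 →ₗ[ℝ] ℝ) (v : V3) (hv : v ≠ 0) :
    sig f (Projectivization.mk ℝ v hv) = (f v)⁻¹ • v := by
  obtain ⟨a, ha⟩ := Projectivization.exists_smul_eq_mk_rep ℝ v hv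
  unfold sig
  rw [← ha]
  have ha0 : (a : ℝ) ≠ 0 := a.ne_zero
  simp only [Units.smul_def, map_smul, smul_eq_mul, smul_smul]
  congr 1
  by_cases h : f v = 0
  · simp [h]
  · field_simp

lemma sig_cont (f : V3 →ₗ[ℝ] ℝ) (p : ℙ ℝ V3) (hp : f p.rep ≠ 0) : ContinuousAt (sig f) p := by
  have h := (oq.continuousAt_comp_iff (g := sig f) (x := ⟨p.rep, p.rep_nonzero⟩))
  rw [Projectivization.mk'_eq_mk, Projectivization.mk_rep] at h
  apply h.1
  have h2 : (sig f ∘ Projectivization.mk' ℝ) = fun v : {v : V3 // v ≠ 0} => (f v.1)⁻¹ • v.1 := by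
    ext1 v
    exact sig_mk f v.1 v.2
  rw [h2]
  have hf : Continuous f := f.continuous_of_finiteDimensional
  exact ((hf.comp continuous_subtype_val).continuousAt.inv₀ hp).smul
    continuous_subtype_val.continuousAt

lemma sig_props (f : V3 →ₗ[ℝ] ℝ) (C : Set (ℙ ℝ V3))
    (hf : ∀ (v : Fin 3 → ℝ) (hv : v ≠ 0), Projectivization.mk ℝ v hv ∈ closure C → f v ≠ 0)
    (p : ℙ ℝ V3) (hp : p ∈ closure C) :
    f (sig f p) = 1 ∧ (∃ h : sig f p ≠ 0, Projectivization.mk ℝ (sig f p) h = p) ∧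
      ContinuousAt (sig f) p ∧ sig f p ∈ closure (aff f C) := by
  have key : ∀ p ∈ closure C, f p.rep ≠ 0 := fun p hp =>
    hf p.rep p.rep_nonzero (by rwa [Projectivization.mk_rep])
  have h1 : ∀ p ∈ closure C, f (sig f p) = 1 ∧
      (∃ h : sig f p ≠ 0, Projectivization.mk ℝ (sig f p) h = p) := by
    intro p hp
    have h0 := key p hp
    have e : f (sig f p) = 1 := by simp [sig, h0]
    have hne : sig f p ≠ 0 := by intro h; rw [h] at e; simp at e
    refine ⟨e, hne, ?_⟩
    conv_rhs => rw [← p.mk_rep]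
    exact mk_smul_eq_s5 _ p.rep_nonzero _ _
  have hc := sig_cont f p (key p hp)
  refine ⟨(h1 p hp).1, (h1 p hp).2, hc, ?_⟩
  have := hc.continuousWithinAt.mem_closure_image hp
  refine closure_mono ?_ this
  rintro _ ⟨q, hq, rfl⟩
  obtain ⟨e, hne, hm⟩ := h1 q (subset_closure hq)
  exact ⟨e, hne, by rwa [hm]⟩

lemma mk_closure (f : V3 →ₗ[ℝ] ℝ) (C : Set (ℙ ℝ V3)) (v : V3) (hv : v ≠ 0)
    (h : v ∈ closure (aff f C)) : Projectivization.mk ℝ v hv ∈ closure C := by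
  have : (⟨v, hv⟩ : {v : V3 // v ≠ 0}) ∈ closure {w : {v : V3 // v ≠ 0} | w.1 ∈ aff f C} := by
    rw [closure_subtype]
    refine closure_mono ?_ h
    intro w hw
    exact ⟨⟨w, hw.2.1⟩, hw, rfl⟩
  exact map_mem_closure oq.continuous this (fun w hw => hw.2.2)

lemma exists_delta (f : V3 →ₗ[ℝ] ℝ) (C : Set (ℙ ℝ V3)) (hC : IsOpen C) (c : V3)
    (hc : c ∈ aff f C) : ∃ δ > 0, ∀ u : V3, ‖u‖ < δ → 0 < f (c + u) ∧
      (f (c + u))⁻¹ • (c + u) ∈ aff f C := by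
  have hf : Continuous f := f.continuous_of_finiteDimensional
  have hO : IsOpen (Subtype.val '' ((Projectivization.mk' ℝ : {v : V3 // v ≠ 0} → ℙ ℝ V3) ⁻¹' C)) :=
    (isOpen_ne (x := (0 : V3))).isOpenMap_subtype_val _ (hC.preimage oq.continuous)
  have hO2 := hO.inter (isOpen_lt continuous_const hf : IsOpen {v : V3 | 0 < f v})
  obtain ⟨δ, hδ, hb⟩ := Metric.isOpen_iff.1 hO2 c
    ⟨⟨⟨c, hc.2.1⟩, hc.2.2, rfl⟩, by simp [hc.1]⟩
  refine ⟨δ, hδ, fun u hu => ?_⟩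
  obtain ⟨⟨w, hw, e⟩, hpos⟩ := hb (show c + u ∈ Metric.ball c δ by simpa using hu)
  have hpos : 0 < f (c + u) := hpos
  have hne : c + u ≠ 0 := e ▸ w.2
  refine ⟨hpos, by rw [map_smul, smul_eq_mul, inv_mul_cancel₀ hpos.ne'], smul_ne_zero (inv_ne_zero hpos.ne') hne, ?_⟩
  rw [mk_smul_eq_s5 _ hne]
  have : w = ⟨c + u, hne⟩ := Subtype.ext e
  rw [this] at hw
  exact hw

lemma exists_func (f : V3 →ₗ[ℝ] ℝ) (C : Set (ℙ ℝ V3)) (hconv : Convex ℝ (aff f C)) (c : V3)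
    (hc : c ∈ aff f C) (δ : ℝ) (hδ : 0 < δ)
    (hd : ∀ u : V3, ‖u‖ < δ → 0 < f (c + u) ∧ (f (c + u))⁻¹ • (c + u) ∈ aff f C)
    (W : Submodule ℝ V3) (hW : finrank ℝ W = 2) (hdis : projLine W ∩ C = ∅) :
    ∃ φ : V3 →ₗ[ℝ] ℝ, LinearMap.ker φ = W ∧ φ c = 1 ∧ (∀ v ∈ closure (aff f C), 0 ≤ φ v) ∧
      ∀ u, |φ u| ≤ 2 / δ * ‖u‖ := by
  have hlt : W < ⊤ := by
    rw [lt_top_iff_ne_top]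
    rintro rfl
    simp at hW
  obtain ⟨φ₀, hφ₀, hle⟩ := W.exists_le_ker_of_lt_top hlt
  have hker : LinearMap.ker φ₀ = W := by
    symm
    apply Submodule.eq_of_le_of_finrank_le hle
    have h1 := LinearMap.finrank_range_add_finrank_ker φ₀
    have h2 : LinearMap.range φ₀ = ⊤ := LinearMap.range_eq_top.2 (LinearMap.surjective hφ₀)
    rw [h2] at h1
    simp at h1
    omega
  have hnot : ∀ v ∈ aff f C, φ₀ v ≠ 0 := by
    intro v hv h0
    have : Projectivization.mk ℝ v hv.2.1 ∈ projLine W ∩ C := by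
      refine ⟨?_, hv.2.2⟩
      change (Projectivization.mk ℝ v hv.2.1).submodule ≤ W
      rw [Projectivization.submodule_mk, Submodule.span_singleton_le_iff_mem, ← hker]
      exact h0
    rw [hdis] at this
    exact this
  have hc0 := hnot c hc
  set φ : V3 →ₗ[ℝ] ℝ := (φ₀ c)⁻¹ • φ₀ with hφ
  have hφc : φ c = 1 := by simp [hφ, hc0]
  have hnot' : ∀ v ∈ aff f C, φ v ≠ 0 := by
    intro v hv
    simp [hφ, hc0, hnot v hv]
  have hpos : ∀ v ∈ aff f C, 0 < φ v := by
    intro v hv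
    by_contra hneg
    push Not at hneg
    have hd : 0 < 1 - φ v := by linarith
    have := hconv hv hc (a := 1 / (1 - φ v)) (b := - φ v / (1 - φ v)) (by positivity)
      (div_nonneg (by linarith) hd.le) (by field_simp; ring)
    apply hnot' _ this
    simp only [map_add, map_smul, smul_eq_mul, hφc]
    field_simp
    ring
  have hsmall : ∀ u : V3, ‖u‖ < δ → -1 < φ u := by
    intro u hu
    obtain ⟨h1, h2⟩ := hd u hu
    have h3 := hpos _ h2
    rw [map_smul, smul_eq_mul] at h3
    have h4 := pos_of_mul_pos_right h3 (by positivity)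
    rw [map_add, hφc] at h4
    linarith
  refine ⟨φ, ?_, hφc, ?_, ?_⟩
  · rw [← hker, hφ, LinearMap.ker_smul _ _ (inv_ne_zero hc0)]
  · intro v hv
    have hcl : IsClosed {v | 0 ≤ φ v} :=
      isClosed_le continuous_const φ.continuous_of_finiteDimensional
    exact closure_minimal (fun v hv => (hpos v hv).le) hcl hv
  · intro u
    by_cases hu : u = 0
    · simp [hu]
    have hn : 0 < ‖u‖ := norm_pos_iff.2 hu
    have hs : ‖(δ / 2 / ‖u‖) • u‖ < δ := by
      rw [norm_smul, Real.norm_of_nonneg (by positivity)]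
      field_simp
      linarith
    have h1 := hsmall _ hs
    have h2 := hsmall (-((δ / 2 / ‖u‖) • u)) (by rwa [norm_neg])
    rw [map_neg] at h2
    rw [map_smul, smul_eq_mul] at h1 h2
    have h3 : |δ / 2 / ‖u‖ * φ u| ≤ 1 := abs_le.2 ⟨h1.le, by linarith⟩
    rw [abs_mul, abs_of_pos (by positivity)] at h3
    have : |φ u| = 2 / δ * ‖u‖ * (δ / 2 / ‖u‖ * |φ u|) := by field_simp
    rw [this]
    exact mul_le_of_le_one_right (by positivity) h3

lemma strict_pos (f : V3 →ₗ[ℝ] ℝ) (C : Set (ℙ ℝ V3)) (hC : IsOpen C)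
    (hconv : Convex ℝ (aff f C))
    (hstrict : StrictlyConvexBoundary C) (W : Submodule ℝ V3) (hW : finrank ℝ W = 2)
    (hdis : projLine W ∩ C = ∅) (Y Z : V3) (hY : Y ≠ 0) (hZ : Z ≠ 0) (fY : f Y = 1) (fZ : f Z = 1)
    (cY : Y ∈ closure (aff f C)) (cZ : Z ∈ closure (aff f C))
    (hYZ : Projectivization.mk ℝ Y hY ≠ Projectivization.mk ℝ Z hZ)
    (bY : Projectivization.mk ℝ Y hY ∈ frontier C) (bZ : Projectivization.mk ℝ Z hZ ∈ frontier C)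
    (wY : Y ∈ W) : Z ∉ W := by
  intro wZ
  set M : V3 := (1 / 2 : ℝ) • Y + (1 / 2 : ℝ) • Z with hM
  have fM : f M = 1 := by simp [hM, fY, fZ]; norm_num
  have hM0 : M ≠ 0 := by intro h; rw [h] at fM; simp at fM
  have wM : M ∈ W := W.add_mem (W.smul_mem _ wY) (W.smul_mem _ wZ)
  have cM : M ∈ closure (aff f C) := hconv.closure cY cZ (by norm_num) (by norm_num) (by norm_num)
  have sub : ∀ (v : V3) (hv : v ≠ 0), v ∈ W → (Projectivization.mk ℝ v hv).submodule ≤ W := by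
    intro v hv h
    rwa [Projectivization.submodule_mk, Submodule.span_singleton_le_iff_mem]
  have bM : Projectivization.mk ℝ M hM0 ∈ frontier C := by
    rw [hC.frontier_eq]
    refine ⟨mk_closure f C M hM0 cM, fun h => ?_⟩
    have : Projectivization.mk ℝ M hM0 ∈ projLine W ∩ C := ⟨sub _ _ wM, h⟩
    rw [hdis] at this
    exact this
  have inj : ∀ (v w : V3) (hv : v ≠ 0) (hw : w ≠ 0), f v = 1 → f w = 1 →
      Projectivization.mk ℝ v hv = Projectivization.mk ℝ w hw → v = w := by
    intro v w hv hw fv fw h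
    obtain ⟨a, rfl⟩ := (Projectivization.mk_eq_mk_iff' ℝ _ _ _ _).1 h
    rw [map_smul, fw, smul_eq_mul, mul_one] at fv
    rw [fv, one_smul]
  have hne : Y ≠ Z := by rintro rfl; exact hYZ rfl
  refine hstrict _ _ _ bY bZ bM hYZ ?_ ?_ W hW ⟨sub _ _ wY, sub _ _ wZ, sub _ _ wM⟩
  · intro h
    apply hne
    have := inj _ _ _ _ fY fM h
    ext i
    have := congrFun this i
    simp [hM] at this
    linarith
  · intro h
    apply hne
    have := inj _ _ _ _ fZ fM h
    ext i
    have := congrFun this i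
    simp [hM] at this
    linarith

/-- If `(y_n)` and `(z_n)` are sequences on the circle with `y_n ≠ z_n`, both
converging to `a`, then the points `ℙ(ξ²(y_n) ∩ ξ²(z_n))` converge to `ξ¹(a)` in `ℙ(ℝ³)`. -/
theorem statement_5
    (C : Set (ℙ ℝ (Fin 3 → ℝ))) (hCopen : IsOpen C) (hCpc : ProperlyConvex C)
    (hstrict : StrictlyConvexBoundary C)
    (hC1 : ∀ p ∈ frontier C, ∃! W : Submodule ℝ (Fin 3 → ℝ), IsSupportingLineAt C W p)
    (ξ₁ : Circle → ℙ ℝ (Fin 3 → ℝ))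
    (hξ₁ : ∃ e : Circle ≃ₜ frontier C, ∀ x, (e x : ℙ ℝ (Fin 3 → ℝ)) = ξ₁ x)
    (ξ₂ : Circle → Submodule ℝ (Fin 3 → ℝ))
    (hξ₂ : ∀ x, IsSupportingLineAt C (ξ₂ x) (ξ₁ x))
    (y z : ℕ → Circle) (hyz : ∀ n, y n ≠ z n) (a : Circle)
    (hy : Tendsto y atTop (𝓝 a)) (hz : Tendsto z atTop (𝓝 a)) :
    ∃ p : ℕ → ℙ ℝ (Fin 3 → ℝ),
      (∀ n, (p n).submodule = ξ₂ (y n) ⊓ ξ₂ (z n)) ∧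
      Tendsto p atTop (𝓝 (ξ₁ a)) := by
  obtain ⟨f, hf, hconv⟩ := hCpc
  change Convex ℝ (aff f C) at hconv
  have bd : ∀ x, ξ₁ x ∈ frontier C := fun x => (hξ₂ x).2.1
  have cl : ∀ x, ξ₁ x ∈ closure C := fun x => frontier_subset_closure (bd x)
  obtain ⟨p₀, hp₀⟩ : C.Nonempty := closure_nonempty_iff.1 ⟨_, cl a⟩
  obtain ⟨c1, ⟨c2, c3⟩, -, -⟩ := sig_props f C hf p₀ (subset_closure hp₀)
  set c := sig f p₀
  have hc : c ∈ aff f C := ⟨c1, c2, by rwa [c3]⟩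
  obtain ⟨δ, hδ, hd⟩ := exists_delta f C hCopen c hc
  have hinj : ∀ x x', x ≠ x' → ξ₁ x ≠ ξ₁ x' := by
    obtain ⟨e, he⟩ := hξ₁
    intro x x' h h'
    rw [← he, ← he] at h'
    exact h (e.injective (Subtype.ext h'))
  have hcont : Continuous ξ₁ := by
    obtain ⟨e, he⟩ := hξ₁
    have : ξ₁ = fun x => (e x : ℙ ℝ (Fin 3 → ℝ)) := funext fun x => (he x).symm
    rw [this]
    exact continuous_subtype_val.comp e.continuous
  choose fY hY contY clY using fun x => sig_props f C hf (ξ₁ x) (cl x)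
  choose neY mkY using hY
  choose Φ hker hΦc hΦpos hΦb using fun x =>
    exists_func f C hconv c hc δ hδ hd (ξ₂ x) (hξ₂ x).1 (hξ₂ x).2.2.2
  have hin : ∀ x, sig f (ξ₁ x) ∈ ξ₂ x := by
    intro x
    have h := (hξ₂ x).2.2.1
    rw [← Submodule.span_singleton_le_iff_mem, ← Projectivization.submodule_mk _ (neY x), mkY x]
    exact h
  have hzero : ∀ x, Φ x (sig f (ξ₁ x)) = 0 := by
    intro x
    have := hin x
    rw [← hker x] at this
    exact this
  have hout : ∀ x x', x ≠ x' → sig f (ξ₁ x') ∉ ξ₂ x := by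
    intro x x' h
    refine strict_pos f C hCopen hconv hstrict (ξ₂ x) (hξ₂ x).1 (hξ₂ x).2.2.2
      (sig f (ξ₁ x)) (sig f (ξ₁ x')) (neY x) (neY x') (fY x) (fY x') (clY x) (clY x') ?_ ?_ ?_ (hin x)
    · rw [mkY, mkY]; exact hinj x x' h
    · rw [mkY]; exact bd x
    · rw [mkY]; exact bd x'
  have hpos : ∀ x x', x ≠ x' → 0 < Φ x (sig f (ξ₁ x')) := by
    intro x x' h
    refine lt_of_le_of_ne (hΦpos x _ (clY x')) fun h0 => hout x x' h ?_
    rw [← hker x]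
    exact h0.symm
  have hfin : ∀ x x', x ≠ x' → finrank ℝ (ξ₂ x ⊓ ξ₂ x' : Submodule ℝ (Fin 3 → ℝ)) = 1 := by
    intro x x' h
    have h1 := Submodule.finrank_sup_add_finrank_inf_eq (ξ₂ x) (ξ₂ x')
    rw [(hξ₂ x).1, (hξ₂ x').1] at h1
    have h2 : finrank ℝ (ξ₂ x) < finrank ℝ (ξ₂ x ⊔ ξ₂ x' : Submodule ℝ (Fin 3 → ℝ)) := by
      apply Submodule.finrank_lt_finrank_of_lt
      refine lt_of_le_of_ne le_sup_left fun he => hout x x' h ?_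
      rw [he]
      exact (le_sup_right : ξ₂ x' ≤ ξ₂ x ⊔ ξ₂ x') (hin x')
    have h3 := Submodule.finrank_le (ξ₂ x ⊔ ξ₂ x')
    rw [(hξ₂ x).1] at h2
    simp only [Module.finrank_fin_fun] at h3
    omega
  refine ⟨fun n => Projectivization.mk'' _ (hfin _ _ (hyz n)),
    fun n => Projectivization.submodule_mk'' _ _, ?_⟩
  have contσ : Tendsto (fun x => sig f (ξ₁ x)) (𝓝 a) (𝓝 (sig f (ξ₁ a))) :=
    (contY a).tendsto.comp hcont.continuousAt
  have hYy := contσ.comp hy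
  have hYz := contσ.comp hz
  have hα : ∀ n, 0 < Φ (z n) (sig f (ξ₁ (y n))) := fun n => hpos _ _ (hyz n).symm
  have hβ : ∀ n, 0 < Φ (y n) (sig f (ξ₁ (z n))) := fun n => hpos _ _ (hyz n)
  set Y : ℕ → V3 := fun n => sig f (ξ₁ (y n)) with hYdef
  set Z : ℕ → V3 := fun n => sig f (ξ₁ (z n)) with hZdef
  set α : ℕ → ℝ := fun n => Φ (z n) (Y n) with hαdef
  set β : ℕ → ℝ := fun n => Φ (y n) (Z n) with hβdef
  replace hα : ∀ n, 0 < α n := hα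
  replace hβ : ∀ n, 0 < β n := hβ
  set w : ℕ → V3 := fun n => Z n + ((β n / (α n + β n)) • (Y n - Z n) -
    (α n * β n / (α n + β n)) • c) with hw
  have hαle : ∀ n, α n ≤ 2 / δ * ‖Y n - Z n‖ := by
    intro n
    have h := hΦb (z n) (Y n - Z n)
    have h0 : Φ (z n) (Z n) = 0 := hzero _
    rw [map_sub, h0, sub_zero] at h
    exact (le_abs_self _).trans h
  have hdiff : Tendsto (fun n => ‖Y n - Z n‖) atTop (𝓝 0) := by
    have := (hYy.sub hYz).norm
    simpa using this
  have hwlim : Tendsto w atTop (𝓝 (sig f (ξ₁ a))) := by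
    have h0 : Tendsto (fun n => (β n / (α n + β n)) • (Y n - Z n) -
        (α n * β n / (α n + β n)) • c) atTop (𝓝 0) := by
      refine squeeze_zero_norm (a := fun n => (1 + 2 / δ * ‖c‖) * ‖Y n - Z n‖) ?_ ?_
      · intro n
        have ha := hα n
        have hb := hβ n
        have hle : β n / (α n + β n) ≤ 1 := by
          rw [div_le_one (by positivity)]; linarith
        have hle2 : α n * β n / (α n + β n) ≤ 2 / δ * ‖Y n - Z n‖ := by
          rw [mul_div_assoc]
          exact (mul_le_of_le_one_right ha.le hle).trans (hαle n)
        refine (norm_sub_le _ _).trans ?_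
        rw [norm_smul, norm_smul, Real.norm_of_nonneg (by positivity),
          Real.norm_of_nonneg (by positivity)]
        have e1 := mul_le_mul_of_nonneg_right hle (norm_nonneg (Y n - Z n))
        have e2 := mul_le_mul_of_nonneg_right hle2 (norm_nonneg c)
        linarith
      · simpa using hdiff.const_mul (1 + 2 / δ * ‖c‖)
    simpa using hYz.add h0
  have hwmem : ∀ n, w n ∈ ξ₂ (y n) ⊓ ξ₂ (z n) := by
    intro n
    have ha := hα n
    have hb := hβ n
    have hy0 : Φ (y n) (Y n) = 0 := hzero _
    have hz0 : Φ (z n) (Z n) = 0 := hzero _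
    have hy1 : Φ (y n) (Z n) = β n := rfl
    have hz1 : Φ (z n) (Y n) = α n := rfl
    rw [← hker, ← hker]
    refine ⟨?_, ?_⟩
    · change Φ (y n) (w n) = 0
      simp only [hw, map_add, map_sub, map_smul, smul_eq_mul, hΦc, hy0, hy1]
      field_simp
      ring
    · change Φ (z n) (w n) = 0
      simp only [hw, map_add, map_sub, map_smul, smul_eq_mul, hΦc, hz0, hz1]
      field_simp
      ring
  have hev : ∀ᶠ n in atTop, w n ≠ 0 := hwlim.eventually_ne (neY a)
  classical
  set w' : ℕ → {v : V3 // v ≠ 0} := fun n =>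
    if h : w n ≠ 0 then ⟨w n, h⟩ else ⟨_, neY a⟩ with hw'
  have hw'lim : Tendsto w' atTop (𝓝 ⟨_, neY a⟩) := by
    rw [tendsto_subtype_rng]
    refine hwlim.congr' ?_
    filter_upwards [hev] with n hn
    simp [hw', hn]
  have hfinal := (oq.continuous.tendsto _).comp hw'lim
  rw [Projectivization.mk'_eq_mk, mkY a] at hfinal
  refine hfinal.congr' ?_
  filter_upwards [hev] with n hn
  have e : w' n = ⟨w n, hn⟩ := by simp [hw', hn]
  apply Projectivization.submodule_injective
  rw [Projectivization.submodule_mk'', Function.comp_apply, e, Projectivization.mk'_eq_mk,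
    Projectivization.submodule_mk]
  apply Submodule.eq_of_le_of_finrank_eq
  · rw [Submodule.span_singleton_le_iff_mem]
    exact hwmem n
  · rw [hfin _ _ (hyz n), finrank_span_singleton hn]

end CFF
end
end

section
/- Fix x ∈ S¹ and let Ω_x = ℙ(ℝ³) ∖ (closure(C) ∪ ℙ(ξ²(x))). Then the map sending p ∈ Ω_x to the flag (p, P_p + x¹), where P_p is the 1-dimensional subspace corresponding to p, is well defined (that is, P_p + x¹ is 2-dimensional and (p, P_p + x¹) ∈ Ω²) and is a homeomorphism from Ω_x onto the set {(p, l) ∈ Ω² : x¹ ⊆ l}. -/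
noncomputable section

open Filter Topology Module
open scoped LinearAlgebra.Projectivization

namespace CFF

theorem continuous_mk : Continuous (fun v : {v : V3 // v ≠ 0} => Projectivization.mk ℝ v.1 v.2) :=
  continuous_quotient_mk'

theorem continuous_mkD : Continuous
    (fun v : {v : Module.Dual ℝ V3 // v ≠ 0} => Projectivization.mk ℝ v.1 v.2) :=
  continuous_quotient_mk'

theorem isOpenMap_mk : IsOpenMap (fun v : {v : V3 // v ≠ 0} => Projectivization.mk ℝ v.1 v.2) := by
  intro U hU
  obtain ⟨O, hO, rfl⟩ := isOpen_induced_iff.1 hU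
  have key : IsOpen ((fun v : {v : V3 // v ≠ 0} => Projectivization.mk ℝ v.1 v.2) ⁻¹'
      ((fun v : {v : V3 // v ≠ 0} => Projectivization.mk ℝ v.1 v.2) '' (Subtype.val ⁻¹' O))) := by
    have : ((fun v : {v : V3 // v ≠ 0} => Projectivization.mk ℝ v.1 v.2) ⁻¹'
      ((fun v : {v : V3 // v ≠ 0} => Projectivization.mk ℝ v.1 v.2) '' (Subtype.val ⁻¹' O)))
        = ⋃ c : ℝˣ, {v : {v : V3 // v ≠ 0} | (c : ℝ) • v.1 ∈ O} := by
      ext v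
      simp only [Set.mem_preimage, Set.mem_image, Set.mem_iUnion, Set.mem_ofPred_eq]
      constructor
      · rintro ⟨w, hw, h⟩
        obtain ⟨c, hc⟩ := (Projectivization.mk_eq_mk_iff ℝ _ _ w.2 v.2).1 h
        exact ⟨c, by rw [← Units.smul_def, hc]; exact hw⟩
      · rintro ⟨c, hc⟩
        refine ⟨⟨(c : ℝ) • v.1, smul_ne_zero c.ne_zero v.2⟩, hc, ?_⟩
        exact (Projectivization.mk_eq_mk_iff ℝ _ _ _ v.2).2 ⟨c, rfl⟩
    rw [this]
    exact isOpen_iUnion fun c => hO.preimage (continuous_subtype_val.const_smul (c : ℝ))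
  exact key

/-- The functional `w ↦ det (v, a, w)`. -/
def Lf (a : V3) : V3 →ₗ[ℝ] Module.Dual ℝ V3 :=
  (dotProductBilin ℝ ℝ).comp (crossProduct.flip a)

theorem Lf_apply (a v w : V3) : Lf a v w = (crossProduct v a) ⬝ᵥ w := rfl

theorem continuous_Lf (a : V3) : Continuous (Lf a) := by
  refine continuous_induced_rng.2 (continuous_pi fun i => ?_)
  have : (fun v => ((LinearEquiv.piRing ℝ ℝ (Fin 3) ℝ) ∘ (Lf a)) v i)
      = fun v => crossProduct v a i := by
    ext v
    simp [LinearEquiv.piRing_apply, Lf_apply]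
  rw [this]
  fin_cases i <;> simp [cross_apply] <;> fun_prop

theorem Lf_ne (a v : V3) (h : LinearIndependent ℝ ![v, a]) : Lf a v ≠ 0 := by
  intro h0
  have : crossProduct v a = 0 := by
    rw [← dotProduct_self_eq_zero, ← Lf_apply, h0]; rfl
  exact (crossProduct_ne_zero_iff_linearIndependent.2 h) this

theorem mk_rep_indep {p q : ℙ ℝ V3} (h : p ≠ q) : LinearIndependent ℝ ![p.rep, q.rep] := by
  have h2 := (Projectivization.independent_pair_iff_ne p q).2 h
  rw [Projectivization.independent_iff] at h2
  have : (Projectivization.rep ∘ ![p, q]) = ![p.rep, q.rep] := by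
    ext i; fin_cases i <;> rfl
  rw [this] at h2
  exact h2

theorem finrank_sup {p q : ℙ ℝ V3} (h : p ≠ q) : finrank ℝ ↥(p.submodule ⊔ q.submodule) = 2 := by
  have h3 := finrank_span_eq_card (mk_rep_indep h)
  have : Submodule.span ℝ (Set.range ![p.rep, q.rep]) = p.submodule ⊔ q.submodule := by
    rw [Projectivization.submodule_eq, Projectivization.submodule_eq, ← Submodule.span_union]
    congr 1
    simp
  rw [this] at h3
  simpa using h3

open Classical in
/-- The line through `p` and `q`. -/
def G (q p : ℙ ℝ V3) : ℙ ℝ (Module.Dual ℝ V3) :=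
  if h : Lf q.rep p.rep ≠ 0 then Projectivization.mk ℝ _ h
  else Projectivization.mk ℝ (LinearMap.proj 0) (fun h => by
    have := congrArg (fun f => f (fun _ => (1 : ℝ))) h
    simp at this)

theorem Lf_smul_ne {q : ℙ ℝ V3} (v : V3) (hv : v ≠ 0) (h : Projectivization.mk ℝ v hv ≠ q) :
    ∃ h : Lf q.rep v ≠ 0, G q (Projectivization.mk ℝ v hv) = Projectivization.mk ℝ _ h := by
  have h1 : Lf q.rep (Projectivization.mk ℝ v hv).rep ≠ 0 := Lf_ne _ _ (mk_rep_indep h)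
  obtain ⟨c, hc⟩ := Projectivization.exists_smul_eq_mk_rep ℝ v hv
  have h2 : Lf q.rep (Projectivization.mk ℝ v hv).rep = c • Lf q.rep v := by
    rw [← hc]; exact map_smul (Lf q.rep) (c : ℝ) v
  have h3 : Lf q.rep v ≠ 0 := fun h0 => h1 (by rw [h2, h0, smul_zero])
  refine ⟨h3, ?_⟩
  rw [G, dif_pos h1]
  exact (Projectivization.mk_eq_mk_iff ℝ _ _ _ _).2 ⟨c, h2.symm⟩

theorem G_continuousAt (q p : ℙ ℝ V3) (h : p ≠ q) : ContinuousAt (G q) p := by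
  induction p using Projectivization.ind with
  | h v hv =>
  let π := (fun v : {v : V3 // v ≠ 0} => Projectivization.mk ℝ v.1 v.2)
  have hm : 𝓝 (Projectivization.mk ℝ v hv) = Filter.map π (𝓝 ⟨v, hv⟩) :=
    (isOpenMap_mk.map_nhds_eq (x := ⟨v, hv⟩) continuous_mk.continuousAt).symm
  obtain ⟨h0, hG⟩ := Lf_smul_ne v hv h
  rw [ContinuousAt, hm, tendsto_map'_iff, hG]
  have hop : IsOpen {f : Module.Dual ℝ V3 | f ≠ 0} := by
    have : {f : Module.Dual ℝ V3 | f ≠ 0} =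
      (LinearEquiv.piRing ℝ ℝ (Fin 3) ℝ) ⁻¹' {0}ᶜ := by
      ext f; simp
    rw [this]
    exact isOpen_compl_singleton.preimage continuous_induced_dom
  have hc : Continuous (fun w : {v : V3 // v ≠ 0} => Lf q.rep w.1) :=
    (continuous_Lf q.rep).comp continuous_subtype_val
  have hev : ∀ᶠ w : {v : V3 // v ≠ 0} in 𝓝 ⟨v, hv⟩, Lf q.rep w.1 ≠ 0 := by
    have hp := hop.preimage hc
    exact hp.mem_nhds (x := ⟨v, hv⟩) h0
  have hne : ∀ w : {v : V3 // v ≠ 0}, Lf q.rep w.1 ≠ 0 → π w ≠ q := by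
    intro w hw he
    apply hw
    have : q.rep ∈ Submodule.span ℝ {w.1} := by
      rw [← Projectivization.submodule_mk w.1 w.2]
      change _ ∈ (π w).submodule
      rw [he, Projectivization.submodule_eq]
      exact Submodule.mem_span_singleton_self _
    obtain ⟨c, hc⟩ := Submodule.mem_span_singleton.1 this
    ext z
    simp [Lf_apply, ← hc]
  intro U hU
  have hU2 := (continuous_mkD.continuousAt (x := ⟨_, h0⟩)).preimage_mem_nhds hU
  obtain ⟨T, hT, hTU⟩ := (mem_nhds_induced Subtype.val _ _).1 hU2
  have ht : Tendsto (fun w : {v : V3 // v ≠ 0} => Lf q.rep w.1) (𝓝 ⟨v, hv⟩) (𝓝 (Lf q.rep v)) :=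
    hc.tendsto (⟨v, hv⟩ : {v : V3 // v ≠ 0})
  have hT2 := ht.eventually_mem hT
  rw [Filter.mem_map]
  filter_upwards [hev, hT2] with w hw hwT
  obtain ⟨h1, h2⟩ := Lf_smul_ne w.1 w.2 (hne w hw)
  change G q (Projectivization.mk ℝ w.1 w.2) ∈ U
  rw [h2]
  exact @hTU ⟨_, h1⟩ hwT

theorem finrank_sub (p : ℙ ℝ (Module.Dual ℝ V3)) : finrank ℝ p.submodule = 1 :=
  Projectivization.finrank_submodule p

theorem finrank_ann {W : Submodule ℝ V3} (h : finrank ℝ W = 2) :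
    finrank ℝ W.dualAnnihilator = 1 := by
  have := Subspace.finrank_add_finrank_dualAnnihilator_eq W
  rw [h] at this
  simp at this
  omega

theorem sub_eq_ann {W : Submodule ℝ V3} (h : finrank ℝ W = 2) (φ : ℙ ℝ (Module.Dual ℝ V3))
    (hφ : W ≤ φ.submodule.dualCoannihilator) : φ.submodule = W.dualAnnihilator := by
  apply Submodule.eq_of_le_of_finrank_eq
  · exact Submodule.le_dualAnnihilator_iff_le_dualCoannihilator.2 hφ
  · rw [finrank_sub, finrank_ann h]

theorem G_sub {p q : ℙ ℝ V3} (h : p ≠ q) :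
    (G q p).submodule = (p.submodule ⊔ q.submodule).dualAnnihilator := by
  apply sub_eq_ann (finrank_sup h)
  have h1 : Lf q.rep p.rep ≠ 0 := Lf_ne _ _ (mk_rep_indep h)
  rw [G, dif_pos h1, Projectivization.submodule_mk, Projectivization.submodule_eq,
    Projectivization.submodule_eq, sup_le_iff]
  constructor
  · rw [Submodule.span_singleton_le_iff_mem, Submodule.mem_dualCoannihilator]
    intro f hf
    obtain ⟨c, rfl⟩ := Submodule.mem_span_singleton.1 hf
    simp [Lf_apply, dotProduct_comm _ p.rep]
  · rw [Submodule.span_singleton_le_iff_mem, Submodule.mem_dualCoannihilator]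
    intro f hf
    obtain ⟨c, rfl⟩ := Submodule.mem_span_singleton.1 hf
    simp [Lf_apply, dotProduct_comm _ q.rep]

/-- For fixed `x`, with `Ω_x = ℙ(ℝ³) ∖ (closure C ∪ ℙ(ξ²(x)))`, the map
sending `p ∈ Ω_x` to the flag `(p, P_p + x¹)` is well defined and a homeomorphism from `Ω_x`
onto `{(p, l) ∈ Ω² : x¹ ⊆ l}`. -/
theorem statement_7
    (C : Set (ℙ ℝ (Fin 3 → ℝ))) (hCopen : IsOpen C) (hCpc : ProperlyConvex C)
    (hstrict : StrictlyConvexBoundary C)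
    (hC1 : ∀ p ∈ frontier C, ∃! W : Submodule ℝ (Fin 3 → ℝ), IsSupportingLineAt C W p)
    (ξ₁ : Circle → ℙ ℝ (Fin 3 → ℝ))
    (hξ₁ : ∃ e : Circle ≃ₜ frontier C, ∀ x, (e x : ℙ ℝ (Fin 3 → ℝ)) = ξ₁ x)
    (ξ₂ : Circle → Submodule ℝ (Fin 3 → ℝ))
    (hξ₂ : ∀ x, IsSupportingLineAt C (ξ₂ x) (ξ₁ x))
    (x : Circle) :
    ∃ F : ℙ ℝ (Fin 3 → ℝ) → ℙ ℝ (Fin 3 → ℝ) × ℙ ℝ (Module.Dual ℝ (Fin 3 → ℝ)),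
      (∀ p ∈ (closure C ∪ projLine (ξ₂ x))ᶜ,
        (F p).1 = p ∧
        finrank ℝ ↥(p.submodule ⊔ (ξ₁ x).submodule) = 2 ∧
        (F p).2.submodule = (p.submodule ⊔ (ξ₁ x).submodule).dualAnnihilator ∧
        F p ∈ Omega2 C) ∧
      ∃ e : ↥((closure C ∪ projLine (ξ₂ x))ᶜ) ≃ₜ
          ↥{pl ∈ Omega2 C | (ξ₁ x).submodule ≤ pl.2.submodule.dualCoannihilator},
        ∀ p, (e p : ℙ ℝ (Fin 3 → ℝ) × ℙ ℝ (Module.Dual ℝ (Fin 3 → ℝ))) = F ↑p := by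
  set q := ξ₁ x with hq
  obtain ⟨hW2, hqf, hqW, hWC⟩ := hξ₂ x
  rw [← hq] at hqf hqW
  have hne : ∀ p ∈ (closure C ∪ projLine (ξ₂ x))ᶜ, p ≠ q := by
    rintro p hp rfl
    exact hp (Or.inr hqW)
  have hO : ∀ p ∈ (closure C ∪ projLine (ξ₂ x))ᶜ, (p, G q p) ∈ Omega2 C ∧
      q.submodule ≤ (G q p).submodule.dualCoannihilator := by
    intro p hp
    have hn := hne p hp
    have hco : (G q p).submodule.dualCoannihilator = p.submodule ⊔ q.submodule := by
      rw [G_sub hn, Subspace.dualAnnihilator_dualCoannihilator_eq]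
    refine ⟨⟨?_, fun h => hp (Or.inl h), ?_⟩, ?_⟩
    · change p.submodule ≤ (G q p).submodule.dualCoannihilator
      rw [hco]; exact le_sup_left
    · change ∃ r ∈ C, r.submodule ≤ (G q p).submodule.dualCoannihilator
      rw [hco]
      by_contra hcon
      push Not at hcon
      have hs : IsSupportingLineAt C (p.submodule ⊔ q.submodule) q :=
        ⟨finrank_sup hn, hqf, le_sup_right, by
          ext r
          simp only [Set.mem_inter_iff, Set.mem_empty_iff_false, iff_false, not_and]
          exact fun h1 h2 => hcon r h2 h1⟩
      have := (hC1 q hqf).unique hs (hξ₂ x)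
      apply hp
      right
      change p.submodule ≤ _
      rw [← this]; exact le_sup_left
    · rw [hco]; exact le_sup_right
  have hinv : ∀ pl : ℙ ℝ (Fin 3 → ℝ) × ℙ ℝ (Module.Dual ℝ (Fin 3 → ℝ)), pl ∈ Omega2 C →
      q.submodule ≤ pl.2.submodule.dualCoannihilator →
      pl.1 ∈ (closure C ∪ projLine (ξ₂ x))ᶜ ∧ G q pl.1 = pl.2 := by
    rintro ⟨p, φ⟩ ⟨h1, h2, r, hrC, hr⟩ h3
    change p.submodule ≤ φ.submodule.dualCoannihilator at h1
    dsimp only at h2 hr h3 ⊢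
    have hn : p ≠ q := by
      rintro rfl
      exact h2 (frontier_subset_closure hqf)
    have hφ := sub_eq_ann (finrank_sup hn) φ (sup_le h1 h3)
    refine ⟨?_, ?_⟩
    · rintro (h | h)
      · exact h2 h
      · have he : p.submodule ⊔ q.submodule = ξ₂ x :=
          Submodule.eq_of_le_of_finrank_eq (sup_le h hqW) (by rw [finrank_sup hn, hW2])
        rw [hφ, Subspace.dualAnnihilator_dualCoannihilator_eq, he] at hr
        have : r ∈ projLine (ξ₂ x) ∩ C := ⟨hr, hrC⟩
        rw [hWC] at this
        exact this
    · apply Projectivization.submodule_injective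
      rw [G_sub hn, hφ]
  refine ⟨fun p => (p, G q p), fun p hp => ⟨rfl, finrank_sup (hne p hp), G_sub (hne p hp),
    (hO p hp).1⟩, ?_⟩
  refine ⟨{ toFun := fun p => ⟨(p.1, G q p.1), hO p.1 p.2⟩
            invFun := fun pl => ⟨pl.1.1, (hinv pl.1 pl.2.1 pl.2.2).1⟩
            left_inv := fun p => rfl
            right_inv := fun pl => Subtype.ext (Prod.ext rfl (hinv pl.1 pl.2.1 pl.2.2).2)
            continuous_toFun := ?_
            continuous_invFun := ?_ }, fun p => rfl⟩
  · refine Continuous.subtype_mk (continuous_subtype_val.prodMk ?_) _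
    rw [continuous_iff_continuousAt]
    intro p
    exact (G_continuousAt q p.1 (hne p.1 p.2)).comp continuous_subtype_val.continuousAt
  · exact Continuous.subtype_mk (continuous_fst.comp continuous_subtype_val) _

end CFF
end
end

section
/- Let (x, y, z) be a triple of pairwise distinct points of S¹. Then the point q = ℙ(ξ²(x) ∩ ξ²(z)) is distinct from ξ¹(y), the projective line through ξ¹(y) and q meets the frontier of C in exactly two points, namely ξ¹(y) and ξ¹(w) for a unique w ∈ S¹ with w ∉ {x, y, z}, the point associated in the same way to the triple (x, w, z) is y, and (x, y, z) is positively oriented if and only if (x, w, z) is negatively oriented. In particular, the map ι(x,y,z) = (x,w,z) is an involution of the set of triples of pairwise distinct points of S¹ that interchanges positively and negatively oriented triples. -/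
noncomputable section

open Filter Topology Module
open scoped LinearAlgebra.Projectivization

namespace CFF

lemma isOpenQuotientMap_mk :
    IsOpenQuotientMap (fun v : {v : V3 // v ≠ 0} => Projectivization.mk ℝ v.1 v.2) := by
  have hq : IsQuotientMap (fun v : {v : V3 // v ≠ 0} => Projectivization.mk ℝ v.1 v.2) :=
    isQuotientMap_quotient_mk' (s := projectivizationSetoid ℝ V3)
  refine ⟨hq.surjective, hq.continuous, ?_⟩
  intro U hU
  rw [← hq.isOpen_preimage]
  have : (fun v : {v : V3 // v ≠ 0} => Projectivization.mk ℝ v.1 v.2) ⁻¹'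
      ((fun v : {v : V3 // v ≠ 0} => Projectivization.mk ℝ v.1 v.2) '' U)
      = ⋃ a : ℝˣ, (fun v : {v : V3 // v ≠ 0} =>
          (⟨a • v.1, (smul_ne_zero_iff_ne a).2 v.2⟩ : {v : V3 // v ≠ 0})) ⁻¹' U := by
    ext v
    simp only [Set.mem_preimage, Set.mem_image, Set.mem_iUnion]
    constructor
    · rintro ⟨u, hu, h⟩
      obtain ⟨a, ha⟩ := (Projectivization.mk_eq_mk_iff ℝ _ _ _ _).1 h
      refine ⟨a, ?_⟩
      convert hu
    · rintro ⟨a, ha⟩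
      exact ⟨_, ha, (Projectivization.mk_eq_mk_iff ℝ _ _ _ _).2 ⟨a, rfl⟩⟩
  rw [this]
  refine isOpen_iUnion fun a => hU.preimage ?_
  refine Continuous.subtype_mk ?_ _
  exact (continuous_const_smul a).comp continuous_subtype_val

/-- normalised representative -/
def nrm (f : V3 →ₗ[ℝ] ℝ) (p : ℙ ℝ V3) : V3 := (f p.rep)⁻¹ • p.rep

lemma nrm_mk (f : V3 →ₗ[ℝ] ℝ) (v : V3) (hv : v ≠ 0) :
    nrm f (Projectivization.mk ℝ v hv) = (f v)⁻¹ • v := by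
  obtain ⟨a, ha⟩ := Projectivization.exists_smul_eq_mk_rep ℝ v hv
  have h0 : (a : ℝ) ≠ 0 := a.ne_zero
  unfold nrm
  rw [← ha, Units.smul_def, map_smul, smul_smul, smul_eq_mul, mul_inv]
  congr 1
  field_simp

lemma continuousAt_nrm (f : V3 →ₗ[ℝ] ℝ) (p : ℙ ℝ V3) (hp : f p.rep ≠ 0) :
    ContinuousAt (nrm f) p := by
  have h := (isOpenQuotientMap_mk.continuousAt_comp_iff (g := nrm f)
    (x := ⟨p.rep, p.rep_nonzero⟩)).1
  simp only [Projectivization.mk_rep] at h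
  apply h
  have : (nrm f ∘ fun v : {v : V3 // v ≠ 0} => Projectivization.mk ℝ v.1 v.2) =
      fun v => (f v.1)⁻¹ • v.1 := by
    ext1 v
    exact nrm_mk f v.1 v.2
  rw [this]
  have hf : Continuous f := f.continuous_of_finiteDimensional
  exact ((hf.comp continuous_subtype_val).continuousAt.inv₀ hp).smul
    continuous_subtype_val.continuousAt

lemma f_nrm (f : V3 →ₗ[ℝ] ℝ) (p : ℙ ℝ V3) (hp : f p.rep ≠ 0) : f (nrm f p) = 1 := by
  unfold nrm
  rw [map_smul, smul_eq_mul, inv_mul_cancel₀ hp]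

lemma nrm_ne_zero (f : V3 →ₗ[ℝ] ℝ) (p : ℙ ℝ V3) (hp : f p.rep ≠ 0) : nrm f p ≠ 0 :=
  smul_ne_zero (inv_ne_zero hp) p.rep_nonzero

lemma mk_nrm (f : V3 →ₗ[ℝ] ℝ) (p : ℙ ℝ V3) (hp : f p.rep ≠ 0) :
    Projectivization.mk ℝ (nrm f p) (nrm_ne_zero f p hp) = p := by
  conv_rhs => rw [← p.mk_rep]
  rw [Projectivization.mk_eq_mk_iff']
  exact ⟨_, rfl⟩

lemma submodule_nrm (f : V3 →ₗ[ℝ] ℝ) (p : ℙ ℝ V3) (hp : f p.rep ≠ 0) :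
    p.submodule = Submodule.span ℝ {nrm f p} := by
  conv_lhs => rw [← mk_nrm f p hp]
  rfl

def chartImg (f : V3 →ₗ[ℝ] ℝ) (C : Set (ℙ ℝ V3)) : Set V3 :=
  {w : V3 | f w = 1 ∧ ∃ hw : w ≠ 0, Projectivization.mk ℝ w hw ∈ C}

lemma nrm_mem_closure (f : V3 →ₗ[ℝ] ℝ) (C : Set (ℙ ℝ V3))
    (hf : ∀ p ∈ closure C, f p.rep ≠ 0) (p : ℙ ℝ V3) (hp : p ∈ closure C) :
    nrm f p ∈ closure (chartImg f C) := by
  refine mem_closure_image (s := C) (continuousAt_nrm f p (hf p hp)) hp |>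
    closure_mono ?_
  rintro _ ⟨q, hq, rfl⟩
  have hq' := hf q (subset_closure hq)
  exact ⟨f_nrm f q hq', nrm_ne_zero f q hq', by rwa [mk_nrm f q hq']⟩

lemma mk_mem_closure (f : V3 →ₗ[ℝ] ℝ) (C : Set (ℙ ℝ V3)) (v : V3) (hv : v ≠ 0)
    (h : v ∈ closure (chartImg f C)) : Projectivization.mk ℝ v hv ∈ closure C := by
  rw [mem_closure_iff] at h ⊢
  intro U hU hvU
  have hO : IsOpen ((↑) '' ((fun v : {v : V3 // v ≠ 0} => Projectivization.mk ℝ v.1 v.2) ⁻¹' U) :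
      Set V3) :=
    (isOpen_ne (x := (0 : V3))).isOpenMap_subtype_val _
      (hU.preimage isOpenQuotientMap_mk.continuous)
  obtain ⟨w, ⟨w', hw', rfl⟩, hwK⟩ := h _ hO ⟨⟨v, hv⟩, hvU, rfl⟩
  exact ⟨_, hw', hwK.2.2⟩

lemma finrank_ker_two (φ : V3 →ₗ[ℝ] ℝ) (h : φ ≠ 0) : finrank ℝ (LinearMap.ker φ) = 2 := by
  have := Module.Dual.finrank_ker_add_one_of_ne_zero (f := φ) h
  simp at this
  exact this

lemma exists_functional_s10 (W : Submodule ℝ V3) (h : finrank ℝ W = 2) :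
    ∃ φ : V3 →ₗ[ℝ] ℝ, LinearMap.ker φ = W := by
  have hlt : W < ⊤ := by
    rw [lt_top_iff_ne_top]
    rintro rfl
    simp at h
  obtain ⟨φ, h0, hle⟩ := W.exists_le_ker_of_lt_top hlt
  refine ⟨φ, (Submodule.eq_of_le_of_finrank_eq hle ?_).symm⟩
  rw [h, finrank_ker_two φ h0]

/-- A supporting functional, positive on `C`. -/
lemma exists_pos_functional (f : V3 →ₗ[ℝ] ℝ) (C : Set (ℙ ℝ V3))
    (hconv : Convex ℝ (chartImg f C)) (W : Submodule ℝ V3) (h : finrank ℝ W = 2)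
    (hd : projLine W ∩ C = ∅) :
    ∃ φ : V3 →ₗ[ℝ] ℝ, LinearMap.ker φ = W ∧ ∀ v ∈ chartImg f C, 0 < φ v := by
  obtain ⟨φ, hφ⟩ := exists_functional_s10 W h
  have hne : ∀ v ∈ chartImg f C, φ v ≠ 0 := by
    rintro v ⟨-, hv, hvC⟩ h0
    have : Projectivization.mk ℝ v hv ∈ projLine W ∩ C := by
      refine ⟨?_, hvC⟩
      change Submodule.span ℝ {v} ≤ W
      rw [Submodule.span_singleton_le_iff_mem, ← hφ]
      exact h0
    rw [hd] at this
    exact this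
  have hφc : Continuous φ := φ.continuous_of_finiteDimensional
  by_cases hp : ∀ v ∈ chartImg f C, 0 < φ v
  · exact ⟨φ, hφ, hp⟩
  · push Not at hp
    obtain ⟨v, hv, hv0⟩ := hp
    refine ⟨-φ, by rw [← hφ]; ext; simp, ?_⟩
    intro u hu
    by_contra hcon
    have hu0 : 0 ≤ φ u := by simpa using hcon
    obtain ⟨t, ht, ht0⟩ := hconv.isPreconnected.intermediate_value hv hu hφc.continuousOn ⟨hv0, hu0⟩
    exact hne t ht ht0

lemma posOriented_iff (a b c : ℝ) (hb : b ∈ Set.Ioo a (a + 2 * Real.pi))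
    (hc : c ∈ Set.Ioo a (a + 2 * Real.pi)) :
    PosOriented (Circle.exp a) (Circle.exp b) (Circle.exp c) ↔ b < c := by
  constructor
  · rintro ⟨a', b', c', ha', hb', hc', h1, h2, h3⟩
    obtain ⟨m, hm⟩ := Circle.exp_eq_exp.1 ha'
    have inj := Circle.exp_injOn_Ico (a := a) (b := a + 2 * Real.pi) (by linarith)
    have key : ∀ s s' : ℝ, s ∈ Set.Ioo a (a + 2 * Real.pi) → Circle.exp s' = Circle.exp s →
        a' < s' → s' < a' + 2 * Real.pi → s' = s + m * (2 * Real.pi) := by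
      intro s s' hs hss h1 h2
      have : s' - m * (2 * Real.pi) = s := by
        apply inj
        · constructor <;> linarith
        · exact ⟨hs.1.le, hs.2⟩
        · rw [← hss]
          exact Circle.exp_eq_exp.2 ⟨-m, by push_cast; ring⟩
      linarith
    have := key b b' hb hb' h1 (by linarith)
    have := key c c' hc hc' (by linarith) h3
    linarith
  · intro h
    exact ⟨a, b, c, rfl, rfl, rfl, hb.1, h, hc.2⟩

lemma exists_angle (a : ℝ) (y : Circle) (h : Circle.exp a ≠ y) :
    ∃ b ∈ Set.Ioo a (a + 2 * Real.pi), Circle.exp b = y := by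
  obtain ⟨t, rfl⟩ := Circle.exp_surjective y
  obtain ⟨b, hb, hbt⟩ := Circle.periodic_exp.exists_mem_Ico Real.two_pi_pos t a
  refine ⟨b, ⟨lt_of_le_of_ne hb.1 ?_, hb.2⟩, hbt.symm⟩
  rintro rfl
  exact h hbt.symm

/-- the plane spanned by `b` and the common kernel. -/
lemma sup_eq_ker (φ χ : V3 →ₗ[ℝ] ℝ) (b : V3) (Q : Submodule ℝ V3)
    (hQ : Q = LinearMap.ker φ ⊓ LinearMap.ker χ) (hb : φ b ≠ 0) (v : V3) :
    v ∈ Submodule.span ℝ {b} ⊔ Q ↔ φ b * χ v - χ b * φ v = 0 := by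
  subst hQ
  rw [Submodule.mem_sup]
  constructor
  · rintro ⟨y, hy, z, ⟨hz1, hz2⟩, rfl⟩
    obtain ⟨t, rfl⟩ := Submodule.mem_span_singleton.1 hy
    have h1 : φ z = 0 := hz1
    have h2 : χ z = 0 := hz2
    simp [h1, h2]
    ring
  · intro h
    refine ⟨(φ v / φ b) • b, Submodule.smul_mem _ _ (Submodule.mem_span_singleton_self b),
      v - (φ v / φ b) • b, ⟨?_, ?_⟩, by simp⟩
    · change φ _ = 0
      simp [hb]
    · change χ _ = 0
      simp only [map_sub, map_smul, smul_eq_mul]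
      field_simp
      linarith

/-- For pairwise distinct `x, y, z`: the point `q = ℙ(ξ²(x) ∩ ξ²(z))` is
distinct from `ξ¹(y)`; the projective line through `ξ¹(y)` and `q` meets the frontier of `C`
exactly in `ξ¹(y)` and `ξ¹(w)` for a (unique) `w ∉ {x,y,z}`; the point associated in the same
way to `(x,w,z)` is `y`; and `(x,y,z)` is positively oriented iff `(x,w,z)` is negatively
oriented.  (This makes `ι(x,y,z) = (x,w,z)` an involution of the set of triples of pairwise
distinct points interchanging positively and negatively oriented triples.) -/
theorem statement_10
    (C : Set (ℙ ℝ (Fin 3 → ℝ))) (hCopen : IsOpen C) (hCpc : ProperlyConvex C)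
    (hstrict : StrictlyConvexBoundary C)
    (hC1 : ∀ p ∈ frontier C, ∃! W : Submodule ℝ (Fin 3 → ℝ), IsSupportingLineAt C W p)
    (ξ₁ : Circle → ℙ ℝ (Fin 3 → ℝ))
    (hξ₁ : ∃ e : Circle ≃ₜ frontier C, ∀ x, (e x : ℙ ℝ (Fin 3 → ℝ)) = ξ₁ x)
    (ξ₂ : Circle → Submodule ℝ (Fin 3 → ℝ))
    (hξ₂ : ∀ x, IsSupportingLineAt C (ξ₂ x) (ξ₁ x))
    (x y z : Circle) (hxy : x ≠ y) (hxz : x ≠ z) (hyz : y ≠ z) :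
    ∃ (q : ℙ ℝ (Fin 3 → ℝ)) (w : Circle),
      q.submodule = ξ₂ x ⊓ ξ₂ z ∧ q ≠ ξ₁ y ∧
      w ≠ x ∧ w ≠ y ∧ w ≠ z ∧
      {s : Circle | (ξ₁ s).submodule ≤ (ξ₁ y).submodule ⊔ q.submodule} = {y, w} ∧
      q ≠ ξ₁ w ∧
      {s : Circle | (ξ₁ s).submodule ≤ (ξ₁ w).submodule ⊔ q.submodule} = {w, y} ∧
      (PosOriented x y z ↔ ¬ PosOriented x w z) := by

  obtain ⟨f, hf0, hconv'⟩ := hCpc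
  have hconv : Convex ℝ (chartImg f C) := hconv'
  have hf : ∀ p ∈ closure C, f p.rep ≠ 0 := by
    intro p hp
    exact hf0 p.rep p.rep_nonzero (by rwa [p.mk_rep])
  obtain ⟨e, he⟩ := hξ₁
  have hfr : ∀ s, ξ₁ s ∈ frontier C := fun s => by rw [← he s]; exact (e s).2
  have hcl : ∀ s, ξ₁ s ∈ closure C := fun s => frontier_subset_closure (hfr s)
  have hfs : ∀ s, f (ξ₁ s).rep ≠ 0 := fun s => hf _ (hcl s)
  have hξinj : Function.Injective ξ₁ := by
    intro s t h
    apply e.injective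
    apply Subtype.ext
    rw [he, he, h]
  have hξcont : Continuous ξ₁ := by
    have : ξ₁ = fun s => (e s : ℙ ℝ (Fin 3 → ℝ)) := by ext1 s; rw [he]
    rw [this]
    exact continuous_subtype_val.comp e.continuous
  set g : Circle → V3 := fun s => nrm f (ξ₁ s) with hg
  have hgcont : Continuous g := by
    rw [continuous_iff_continuousAt]
    intro s
    exact (continuousAt_nrm f _ (hfs s)).comp hξcont.continuousAt
  have hgcl : ∀ s, g s ∈ closure (chartImg f C) := fun s => nrm_mem_closure f C hf _ (hcl s)
  have hgsub : ∀ s, (ξ₁ s).submodule = Submodule.span ℝ {g s} := fun s =>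
    submodule_nrm f _ (hfs s)
  have hf1 : ∀ s, f (g s) = 1 := fun s => f_nrm f _ (hfs s)
  -- supporting functionals
  have hsup : ∀ s, ∃ φ : V3 →ₗ[ℝ] ℝ, LinearMap.ker φ = ξ₂ s ∧ φ (g s) = 0 ∧
      ∀ t, t ≠ s → 0 < φ (g t) := by
    intro s
    obtain ⟨h2, -, hle, hd⟩ := hξ₂ s
    obtain ⟨φ, hker, hpos⟩ := exists_pos_functional f C hconv _ h2 hd
    have hs0 : φ (g s) = 0 := by
      rw [hgsub, Submodule.span_singleton_le_iff_mem, ← hker] at hle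
      exact hle
    have hφc : Continuous φ := φ.continuous_of_finiteDimensional
    have hnn : ∀ v ∈ closure (chartImg f C), 0 ≤ φ v := by
      intro v hv
      have : closure (chartImg f C) ⊆ {v | 0 ≤ φ v} :=
        closure_minimal (fun v hv => (hpos v hv).le) (isClosed_le continuous_const hφc)
      exact this hv
    refine ⟨φ, hker, hs0, fun t hts => lt_of_le_of_ne (hnn _ (hgcl t)) ?_⟩
    intro h0
    -- midpoint
    set m : V3 := (1/2 : ℝ) • g s + (1/2 : ℝ) • g t with hm
    have hmcl : m ∈ closure (chartImg f C) :=
      hconv.closure (hgcl s) (hgcl t) (by norm_num) (by norm_num) (by norm_num)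
    have hfm : f m = 1 := by
      rw [hm]; simp only [map_add, map_smul, hf1, smul_eq_mul]; norm_num
    have hm0 : m ≠ 0 := by
      intro h; rw [h, map_zero] at hfm; norm_num at hfm
    have hφm : φ m = 0 := by
      rw [hm]; simp [hs0, ← h0]
    have hmC : Projectivization.mk ℝ m hm0 ∈ frontier C := by
      rw [hCopen.frontier_eq]
      refine ⟨mk_mem_closure f C m hm0 hmcl, fun hC => ?_⟩
      have := hpos m ⟨hfm, hm0, hC⟩
      linarith
    have hst : g s ≠ g t := by
      intro h
      apply hts
      apply hξinj
      rw [← mk_nrm f (ξ₁ s) (hfs s), ← mk_nrm f (ξ₁ t) (hfs t)]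
      congr 1
      exact h.symm
    have hne : ∀ r, g r ≠ m → ξ₁ r ≠ Projectivization.mk ℝ m hm0 := by
      intro r hr h
      apply hr
      have : nrm f (ξ₁ r) = nrm f (Projectivization.mk ℝ m hm0) := by rw [h]
      rw [nrm_mk, hfm] at this
      simpa using this
    have e1 : g s ≠ m := by
      intro h
      apply hst
      have h' : g s - m = (1/2 : ℝ) • (g s - g t) := by rw [hm]; module
      rw [← h, sub_self] at h'
      have := (smul_eq_zero.1 h'.symm).resolve_left (by norm_num)
      exact sub_eq_zero.1 this
    have e2 : g t ≠ m := by
      intro h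
      apply hst
      have h' : g t - m = (1/2 : ℝ) • (g t - g s) := by rw [hm]; module
      rw [← h, sub_self] at h'
      have := (smul_eq_zero.1 h'.symm).resolve_left (by norm_num)
      exact (sub_eq_zero.1 this).symm
    refine hstrict (ξ₁ s) (ξ₁ t) (Projectivization.mk ℝ m hm0) (hfr s) (hfr t) hmC
      (fun h => hts (hξinj h).symm) (hne s e1) (hne t e2) (ξ₂ s) h2 ⟨?_, ?_, ?_⟩
    · exact hle
    · rw [hgsub, Submodule.span_singleton_le_iff_mem, ← hker]; exact h0.symm
    · rw [Projectivization.submodule_mk, Submodule.span_singleton_le_iff_mem, ← hker]; exact hφm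
  obtain ⟨φ, hφk, hφ0, hφp⟩ := hsup x
  obtain ⟨χ, hχk, hχ0, hχp⟩ := hsup z
  -- the intersection point
  have hrk : finrank ℝ (ξ₂ x ⊓ ξ₂ z : Submodule ℝ (Fin 3 → ℝ)) = 1 := by
    have h1 := (hξ₂ x).1
    have h2 := (hξ₂ z).1
    have hsum := Submodule.finrank_sup_add_finrank_inf_eq (ξ₂ x) (ξ₂ z)
    have hle : finrank ℝ (ξ₂ x ⊔ ξ₂ z : Submodule ℝ (Fin 3 → ℝ)) ≤ 3 := by
      simpa using Submodule.finrank_le (ξ₂ x ⊔ ξ₂ z)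
    have hlt : ξ₂ x < ξ₂ x ⊔ ξ₂ z := by
      rw [left_lt_sup, ← hφk, ← hχk]
      intro h
      have : φ (g z) = 0 := h hχ0
      have := hφp z hxz.symm
      linarith
    have := Submodule.finrank_lt_finrank_of_lt hlt
    omega
  set q : ℙ ℝ (Fin 3 → ℝ) := Projectivization.mk'' _ hrk with hq
  have hqs : q.submodule = ξ₂ x ⊓ ξ₂ z := Projectivization.submodule_mk'' _ _
  have hqs' : q.submodule = LinearMap.ker φ ⊓ LinearMap.ker χ := by rw [hqs, hφk, hχk]
  have hqne : ∀ s, s ≠ x → q ≠ ξ₁ s := by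
    intro s hs h
    have h1 : g s ∈ q.submodule := by
      rw [h, hgsub]; exact Submodule.mem_span_singleton_self _
    rw [hqs'] at h1
    have h2 : φ (g s) = 0 := h1.1
    have := hφp s hs
    linarith
  have hmem : ∀ r s, r ≠ x → ((ξ₁ s).submodule ≤ (ξ₁ r).submodule ⊔ q.submodule ↔
      φ (g r) * χ (g s) - χ (g r) * φ (g s) = 0) := by
    intro r s hr
    rw [hgsub, hgsub, Submodule.span_singleton_le_iff_mem]
    exact sup_eq_ker φ χ (g r) _ hqs' (hφp r hr).ne' _
  have hφy := hφp y hxy.symm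
  have hχy := hχp y hyz
  have hχx := hχp x hxz
  have hφz := hφp z hxz.symm
  -- angles
  obtain ⟨a, rfl⟩ := Circle.exp_surjective x
  obtain ⟨b, hb, rfl⟩ := exists_angle a y hxy
  obtain ⟨c, hc, rfl⟩ := exists_angle a z hxz
  have hbc : b ≠ c := fun h => hyz (by rw [h])
  set G : ℝ → ℝ := fun t => φ (g (Circle.exp b)) * χ (g (Circle.exp t))
    - χ (g (Circle.exp b)) * φ (g (Circle.exp t)) with hG
  have hGc : Continuous G := by
    have h1 : Continuous φ := φ.continuous_of_finiteDimensional
    have h2 : Continuous χ := χ.continuous_of_finiteDimensional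
    have h3 : Continuous fun t : ℝ => g (Circle.exp t) := hgcont.comp Circle.exp.continuous
    exact (continuous_const.mul (h2.comp h3)).sub (continuous_const.mul (h1.comp h3))
  have hGa : 0 < G a := by
    simp only [hG, hφ0, mul_zero, sub_zero]
    exact mul_pos hφy hχx
  have hGa' : 0 < G (a + 2 * Real.pi) := by
    have : G (a + 2 * Real.pi) = G a := by simp only [hG, Circle.exp_add_two_pi]
    rwa [this]
  have hGz : G c < 0 := by
    simp only [hG, hχ0, mul_zero, zero_sub]
    linarith [mul_pos hχy hφz]
  have ht : ∃ t ∈ Set.Ioo a (a + 2 * Real.pi), G t = 0 ∧ (b < c ↔ ¬ t < c) := by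
    rcases lt_or_gt_of_ne hbc with h | h
    · obtain ⟨t, ht, ht0⟩ := intermediate_value_Ioo hc.2.le hGc.continuousOn ⟨hGz, hGa'⟩
      exact ⟨t, ⟨hc.1.trans ht.1, ht.2⟩, ht0, by simp [h, ht.1.le]⟩
    · obtain ⟨t, ht, ht0⟩ := intermediate_value_Ioo' hc.1.le hGc.continuousOn ⟨hGz, hGa⟩
      exact ⟨t, ⟨ht.1, ht.2.trans hc.2⟩, ht0, by simp [h.le, ht.2]⟩
  obtain ⟨t, htm, ht0, hiff⟩ := ht
  have hor : PosOriented (Circle.exp a) (Circle.exp b) (Circle.exp c) ↔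
      ¬ PosOriented (Circle.exp a) (Circle.exp t) (Circle.exp c) := by
    rw [posOriented_iff a b c hb hc, posOriented_iff a t c htm hc, hiff]
  have hwx : Circle.exp t ≠ Circle.exp a := by
    intro h
    have : G t = G a := by simp only [hG, h]
    linarith
  have hwz : Circle.exp t ≠ Circle.exp c := by
    intro h
    have : G t = G c := by simp only [hG, h]
    linarith
  have hwy : Circle.exp t ≠ Circle.exp b := by
    intro h
    rw [h] at hor
    tauto
  -- at most two points
  have hset : ∀ r r', r ≠ Circle.exp a → r ≠ r' →
      φ (g r) * χ (g r') - χ (g r) * φ (g r') = 0 →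
      {s : Circle | (ξ₁ s).submodule ≤ (ξ₁ r).submodule ⊔ q.submodule} = {r, r'} := by
    intro r r' hr hrr h0
    ext s
    rw [Set.mem_setOf_eq, Set.mem_insert_iff, Set.mem_singleton_iff]
    constructor
    · intro hs
      by_contra hcon
      push Not at hcon
      obtain ⟨hs1, hs2⟩ := hcon
      have hψ : finrank ℝ ((ξ₁ r).submodule ⊔ q.submodule : Submodule ℝ (Fin 3 → ℝ)) = 2 := by
        have h1 := (ξ₁ r).finrank_submodule
        have h2 := q.finrank_submodule
        have hsum := Submodule.finrank_sup_add_finrank_inf_eq (ξ₁ r).submodule q.submodule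
        have h3 : (ξ₁ r).submodule ⊓ q.submodule = ⊥ := by
          rw [eq_bot_iff]
          rintro v ⟨hv1, hv2⟩
          rw [hgsub] at hv1
          obtain ⟨k, rfl⟩ := Submodule.mem_span_singleton.1 hv1
          rw [hqs'] at hv2
          have h4 : φ (k • g r) = 0 := hv2.1
          rw [map_smul, smul_eq_mul] at h4
          have := (mul_eq_zero.1 h4).resolve_right (hφp r hr).ne'
          simp [this]
        rw [h3, finrank_bot] at hsum
        omega
      exact hstrict (ξ₁ r) (ξ₁ r') (ξ₁ s) (hfr _) (hfr _) (hfr _) (fun h => hrr (hξinj h))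
        (fun h => hs1 (hξinj h).symm) (fun h => hs2 (hξinj h).symm) _ hψ
        ⟨le_sup_left, (hmem r r' hr).2 h0, hs⟩
    · rintro (rfl | rfl)
      · exact le_sup_left
      · exact (hmem r s hr).2 h0
  refine ⟨q, Circle.exp t, hqs, hqne _ hxy.symm, hwx, hwy, hwz, hset _ _ hxy.symm hwy.symm ht0,
    hqne _ hwx, hset _ _ hwx hwy ?_, hor⟩
  simp only [hG] at ht0
  linarith

end CFF
end
end
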